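/- arXiv:2210.07363 — 8 statements merged into one kernel-verified Lean document; each statement's English description precedes it below -/
import Mathlib

section
/- There is an absolute constant C such that the following holds. Let G be a finite simple graph on n ≥ 2 vertices with maximum degree Δ ≥ 1, let c be a proper partial (Δ+1)-edge colouring of G, and let U be the set of edges left uncoloured by c. Then there exist a subset W ⊆ U with |W| ≥ |U| / (C·(Δ+1)^{12}·log n) and, for each edge e ∈ W, an augmenting subgraph H_e for e containing at most C·(Δ+1)^8·log n edges, such that the subgraphs {H_e : e ∈ W} are pairwise vertex-disjoint. -/
open SimpleGraph

variable {V : Type*}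

/-- A proper partial edge colouring: every coloured element is an edge, colours are
positive integers, and two distinct edges sharing an endpoint never receive the
same colour. -/
def IsProperPartial (G : SimpleGraph V) (c : Sym2 V → Option ℕ) : Prop :=
  (∀ e κ, c e = some κ → e ∈ G.edgeSet ∧ 1 ≤ κ) ∧
  ∀ e₁ e₂ κ, e₁ ≠ e₂ → (∃ z, z ∈ e₁ ∧ z ∈ e₂) → c e₁ = some κ → c e₂ ≠ some κ

/-- A proper partial `(Δ+1)`-edge colouring. -/
def IsProperPartialVizing (G : SimpleGraph V) [Fintype V] [DecidableRel G.Adj]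
    (c : Sym2 V → Option ℕ) : Prop :=
  IsProperPartial G c ∧ ∀ e κ, c e = some κ → κ ≤ G.maxDegree + 1

/-- `H` is an augmenting subgraph for the uncoloured edge `e`: `H` contains `e` and there
is a proper partial `(Δ+1)`-edge colouring `c'` colouring `e`, colouring every edge
coloured by `c`, and agreeing with `c` outside `H`. -/
def IsAugmentingSubgraph (G : SimpleGraph V) [Fintype V] [DecidableRel G.Adj]
    (c : Sym2 V → Option ℕ) (e : Sym2 V) (H : G.Subgraph) : Prop :=
  e ∈ H.edgeSet ∧
  ∃ c' : Sym2 V → Option ℕ, IsProperPartialVizing G c' ∧ c' e ≠ none ∧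
    (∀ f, c f ≠ none → c' f ≠ none) ∧ ∀ f, f ∉ H.edgeSet → c' f = c f

/-- A proper partial edge colouring with colours in `{1, …, D}`, stated on pairs of vertices. -/
def ProperOn (G : SimpleGraph V) (D : ℕ) (c : Sym2 V → Option ℕ) : Prop :=
  (∀ v w k, c s(v, w) = some k → G.Adj v w ∧ 1 ≤ k ∧ k ≤ D) ∧
  ∀ v w w' k, c s(v, w) = some k → c s(v, w') = some k → w = w'

/-- The colour `k` appears on no edge at `v`. -/
def Missing (c : Sym2 V → Option ℕ) (v : V) (k : ℕ) : Prop :=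
  ∀ w, c s(v, w) ≠ some k

/-- The sequence `a, b, a, b, …`. -/
def altColour (a b s : ℕ) : ℕ := if Even s then a else b

/-- The first `L` steps of `p` follow edges coloured `a, b, a, b, …`. -/
def IsAlternating (c : Sym2 V → Option ℕ) (a b : ℕ) (p : ℕ → V) (L : ℕ) : Prop :=
  ∀ s < L, c s(p s, p (s + 1)) = some (altColour a b s)

open Classical in
/-- The colouring `c` with the value at `e` replaced by `o`. -/
noncomputable def recolour (c : Sym2 V → Option ℕ) (e : Sym2 V) (o : Option ℕ) :
    Sym2 V → Option ℕ :=
  fun f => if f = e then o else c f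

/-- Move the colour of `zw` to the edge `zu`, leaving `zw` uncoloured. -/
noncomputable def moveColour (c : Sym2 V → Option ℕ) (z u w : V) : Sym2 V → Option ℕ :=
  recolour (recolour c s(z, u) (c s(z, w))) s(z, w) none

section Basic

variable {G : SimpleGraph V} {D : ℕ} {c : Sym2 V → Option ℕ}

theorem altColour_zero (a b : ℕ) : altColour a b 0 = a := by simp [altColour]

theorem altColour_one (a b : ℕ) : altColour a b 1 = b := by simp [altColour]

theorem altColour_add_two (a b s : ℕ) : altColour a b (s + 2) = altColour a b s := by
  simp [altColour, Nat.even_add]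

theorem altColour_ne_succ {a b : ℕ} (h : a ≠ b) (s : ℕ) :
    altColour a b s ≠ altColour a b (s + 1) := by
  unfold altColour; rcases Nat.even_or_odd s with hs | hs <;> simp [Nat.even_add_one, hs] <;> grind

theorem altColour_eq_or (a b s : ℕ) :
    (altColour a b s = a ∧ altColour a b (s + 1) = b) ∨
      (altColour a b s = b ∧ altColour a b (s + 1) = a) := by
  unfold altColour; rcases Nat.even_or_odd s with hs | hs <;> simp [Nat.even_add_one, hs]

theorem altColour_mem_pair (a b s t : ℕ) :
    altColour a b s = altColour a b t ∨ altColour a b s = altColour a b (t + 1) := by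
  have := altColour_eq_or a b t
  have := altColour_eq_or a b s
  grind

theorem ProperOn.ne (h : ProperOn G D c) {v w : V} {k : ℕ} (e : c s(v, w) = some k) : v ≠ w :=
  (h.1 v w k e).1.ne

theorem recolour_self (e : Sym2 V) (o : Option ℕ) : recolour c e o e = o := by
  simp [recolour]

theorem recolour_of_ne {e f : Sym2 V} (o : Option ℕ) (h : f ≠ e) : recolour c e o f = c f := by
  simp [recolour, h]

theorem ProperOn.recolour_some (h : ProperOn G D c) {u v : V} {k : ℕ} (huv : G.Adj u v)
    (hk : 1 ≤ k) (hkD : k ≤ D) (hu : Missing c u k) (hv : Missing c v k) :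
    ProperOn G D (recolour c s(u, v) (some k)) := by
  have h1 := h.1
  have h2 := h.2
  have := huv.symm
  unfold Missing at hu hv
  constructor
  · intro a b l hl
    simp only [recolour, Sym2.eq_iff] at hl
    grind
  · intro a b b' l hl hl'
    have e1 : s(u, a) = s(a, u) := Sym2.eq_swap
    have e2 : s(v, a) = s(a, v) := Sym2.eq_swap
    simp only [recolour, Sym2.eq_iff] at hl hl'
    split_ifs at hl hl' <;> grind

theorem ProperOn.moveColour (h : ProperOn G D c) {z u w : V} {k : ℕ} (hzu : G.Adj z u)
    (hk : c s(z, w) = some k) (hu : Missing c u k) : ProperOn G D (moveColour c z u w) := by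
  have h1 := h.1
  have h2 := h.2
  have := hzu.symm
  have hb := h1 _ _ _ hk
  unfold Missing at hu
  constructor
  · intro a b l hl
    simp only [_root_.moveColour, recolour, Sym2.eq_iff] at hl
    grind
  · intro a b b' l hl hl'
    have e1 : ∀ x y : V, c s(x, y) = c s(y, x) := fun x y => by rw [Sym2.eq_swap]
    simp only [_root_.moveColour, recolour, Sym2.eq_iff] at hl hl'
    split_ifs at hl hl' <;> grind

theorem moveColour_right (z u w : V) : moveColour c z u w s(z, w) = none := recolour_self _ _

theorem moveColour_left {z u w : V} (h : u ≠ w) : moveColour c z u w s(z, u) = c s(z, w) := by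
  rw [moveColour, recolour_of_ne, recolour_self]
  simp only [ne_eq, Sym2.eq_iff]
  grind

theorem moveColour_of_ne {z u w : V} {f : Sym2 V} (h1 : f ≠ s(z, u)) (h2 : f ≠ s(z, w)) :
    moveColour c z u w f = c f := by
  rw [moveColour, recolour_of_ne _ h2, recolour_of_ne _ h1]

theorem Missing.moveColour {z u w v : V} {k : ℕ} (hv : Missing c v k) (hvu : v ≠ u) :
    Missing (moveColour c z u w) v k := by
  intro x
  have := hv x
  have := hv w
  simp only [_root_.moveColour, recolour, Sym2.eq_iff]
  grind

theorem ProperOn.missing_moveColour (h : ProperOn G D c) {z u w : V} {k : ℕ}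
    (hk : c s(z, w) = some k) : Missing (_root_.moveColour c z u w) w k := by
  intro x
  have h2 := h.2
  have e1 : ∀ x y : V, c s(x, y) = c s(y, x) := fun x y => by rw [Sym2.eq_swap]
  have := h.ne hk
  simp only [_root_.moveColour, recolour, Sym2.eq_iff]
  grind

theorem IsAlternating.mono {a b : ℕ} {p : ℕ → V} {L M : ℕ} (h : IsAlternating c a b p L)
    (hM : M ≤ L) : IsAlternating c a b p M := fun s hs => h s (hs.trans_le hM)

theorem IsAlternating.prev {a b : ℕ} {p : ℕ → V} {L t : ℕ} (h : IsAlternating c a b p L)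
    (ht : t + 1 ≤ L) : c s(p (t + 1), p t) = some (altColour a b t) := by
  rw [Sym2.eq_swap]; exact h t ht

/-- An alternating walk from a vertex missing the second colour is a path. -/
theorem ProperOn.alternating_injective (h : ProperOn G D c) {a b : ℕ} (hab : a ≠ b) {p : ℕ → V}
    {L : ℕ} (hp : IsAlternating c a b p L) (h0 : Missing c (p 0) b) :
    ∀ t ≤ L, ∀ s < t, p s ≠ p t := by
  intro t
  induction t with
  | zero => intro _ s hs; omega
  | succ t ih =>
    intro ht s hs e
    have harr := hp.prev ht
    rw [← e] at harr
    have hlv := hp s (by omega)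
    rcases altColour_mem_pair a b t s with hc | hc
    · rw [hc] at harr
      have e' := h.2 _ _ _ _ harr hlv
      rcases Nat.lt_trichotomy (s + 1) t with h1 | h1 | h1
      · exact ih (by omega) (s + 1) h1 e'.symm
      · subst h1; exact altColour_ne_succ hab s hc.symm
      · have : t = s := by omega
        subst this
        exact h.ne hlv e'
    · rw [hc] at harr
      rcases s with _ | s
      · rw [altColour_one] at harr; exact h0 _ harr
      · have h3 := hp.prev (t := s) (by omega)
        rw [altColour_add_two] at harr
        have e' := h.2 _ _ _ _ harr h3
        exact ih (by omega) s (by omega) e'.symm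

/-- Walking backwards from a vertex along an alternating path determines the path. -/
theorem ProperOn.alternating_unique (h : ProperOn G D c) {a b a' b' : ℕ} {p q : ℕ → V}
    {L L' : ℕ} (hp : IsAlternating c a b p L) (hq : IsAlternating c a' b' q L')
    (hp0 : Missing c (p 0) b) (hq0 : Missing c (q 0) b') :
    ∀ t ≤ L, ∀ t' ≤ L', p t = q t' → altColour a b t = altColour a' b' t' →
      altColour a b (t + 1) = altColour a' b' (t' + 1) → p 0 = q 0 ∧ t = t' := by
  intro t
  induction t with
  | zero =>
    intro _ t' ht' e h1 h2
    rcases t' with _ | t'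
    · exact ⟨e, rfl⟩
    · have := hq.prev ht'
      rw [altColour_add_two, altColour_one] at h2
      rw [← e, ← h2] at this
      exact (hp0 _ this).elim
  | succ t ih =>
    intro ht t' ht' e h1 h2
    have hpt := hp.prev ht
    rw [altColour_add_two] at h2
    rcases t' with _ | t'
    · rw [e, h2, altColour_one] at hpt
      exact (hq0 _ hpt).elim
    · have := hq.prev ht'
      rw [altColour_add_two] at h2
      rw [← e, ← h2] at this
      have := ih (by omega) t' (by omega) (h.2 _ _ _ _ hpt this) h2 h1
      exact ⟨this.1, by omega⟩

/-- Alternating walks with the same start and colours agree. -/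
theorem ProperOn.alternating_congr (h : ProperOn G D c) {a b : ℕ} {p q : ℕ → V} {L L' : ℕ}
    (hp : IsAlternating c a b p L) (hq : IsAlternating c a b q L') (h0 : p 0 = q 0) :
    ∀ t ≤ L, t ≤ L' → p t = q t := by
  intro t
  induction t with
  | zero => intro _ _; exact h0
  | succ t ih =>
    intro h1 h2
    have e := ih (by omega) (by omega)
    have := hp t h1
    rw [e] at this
    exact h.2 _ _ _ _ this (hq t h2)

/-- Every alternating walk can be followed for `N` steps unless it gets stuck earlier. -/
theorem exists_alternating (c : Sym2 V → Option ℕ) (a b : ℕ) (v : V) (N : ℕ) :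
    ∃ (p : ℕ → V) (L : ℕ), p 0 = v ∧ L ≤ N ∧ IsAlternating c a b p L ∧
      (L = N ∨ Missing c (p L) (altColour a b L)) := by
  induction N with
  | zero => exact ⟨fun _ => v, 0, rfl, le_rfl, fun s hs => by omega, Or.inl rfl⟩
  | succ N ih =>
    obtain ⟨p, L, h0, hL, hp, hm⟩ := ih
    by_cases hm' : Missing c (p L) (altColour a b L)
    · exact ⟨p, L, h0, by omega, hp, Or.inr hm'⟩
    · obtain rfl := hm.resolve_right hm'
      unfold Missing at hm'
      push Not at hm'
      obtain ⟨w, hw⟩ := hm'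
      refine ⟨fun s => if s ≤ L then p s else w, L + 1, by simp [h0], le_rfl, ?_, Or.inl rfl⟩
      intro s hs
      rcases Nat.lt_succ_iff_lt_or_eq.1 hs with h | rfl
      · simpa [h.le, Nat.succ_le_of_lt h] using hp s h
      · simpa using hw

end Basic

section Fan

variable {G : SimpleGraph V} {D : ℕ} {c : Sym2 V → Option ℕ}

theorem exists_rotation (h : ProperOn G D c) {x : V} {y : ℕ → V} {m : V → ℕ}
    (h0 : c s(x, y 0) = none) (hadj : G.Adj x (y 0)) (k : ℕ)
    (hfan : ∀ j < k, c s(x, y (j + 1)) = some (m (y j)))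
    (hinj : ∀ i j, i ≤ k → j ≤ k → y i = y j → i = j)
    (hm : ∀ j ≤ k, Missing c (y j) (m (y j))) :
    ∃ c', ProperOn G D c' ∧ c' s(x, y k) = none ∧ (∀ j < k, c' s(x, y j) = some (m (y j))) ∧
      (∀ f, (∀ j ≤ k, f ≠ s(x, y j)) → c' f = c f) ∧
      ∀ v l, (∀ j < k, v ≠ y j) → Missing c v l → Missing c' v l := by
  induction k with
  | zero => exact ⟨c, h, h0, fun j hj => by omega, fun _ _ => rfl, fun _ _ _ hv => hv⟩
  | succ k ih =>
    obtain ⟨c', hc', hn, hs, heq, hmiss⟩ := ih (fun j hj => hfan j (by omega))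
      (fun i j hi hj => hinj i j (by omega) (by omega)) fun j hj => hm j (by omega)
    have hadj' : G.Adj x (y k) := by
      rcases k with _ | k
      · exact hadj
      · exact (h.1 _ _ _ (hfan k (by omega))).1
    have hne : ∀ j ≤ k, y (k + 1) ≠ y j := fun j hj e => by
      have := hinj _ _ le_rfl (by omega) e; omega
    have hcol : c' s(x, y (k + 1)) = some (m (y k)) := by
      rw [heq, hfan k (by omega)]
      intro j hj e
      exact hne j hj (Sym2.congr_right.1 e)
    have hmk : Missing c' (y k) (m (y k)) := by
      refine hmiss _ _ (fun j hj e => ?_) (hm k (by omega))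
      have := hinj _ _ (by omega) (by omega) e; omega
    refine ⟨moveColour c' x (y k) (y (k + 1)), hc'.moveColour hadj' hcol hmk,
      moveColour_right _ _ _, ?_, ?_, ?_⟩
    · intro j hj
      rcases Nat.lt_succ_iff_lt_or_eq.1 hj with hj' | rfl
      · rw [moveColour_of_ne, hs j hj']
        · intro e
          have := hinj _ _ (by omega) (by omega) (Sym2.congr_right.1 e); omega
        · intro e
          exact hne j hj'.le (Sym2.congr_right.1 e).symm
      · rw [moveColour_left (hne j le_rfl).symm, hcol]
    · intro f hf
      rw [moveColour_of_ne (hf k (by omega)) (hf (k + 1) le_rfl)]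
      exact heq f fun j hj => hf j (by omega)
    · intro v l hv hl
      exact (hmiss v l (fun j hj => hv j (by omega)) hl).moveColour (hv k (by omega))

theorem exists_maximal_fan [Fintype V] {x y : V} (m : V → ℕ) (h0 : c s(x, y) = none) :
    ∃ (k : ℕ) (f : ℕ → V), f 0 = y ∧ (∀ j < k, c s(x, f (j + 1)) = some (m (f j))) ∧
      (∀ i j, i ≤ k → j ≤ k → f i = f j → i = j) ∧
      (Missing c x (m (f k)) ∨ ∃ i < k, m (f i) = m (f k)) := by
  by_contra hcon
  push Not at hcon
  have key : ∀ k, ∃ f : ℕ → V, f 0 = y ∧ (∀ j < k, c s(x, f (j + 1)) = some (m (f j))) ∧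
      (∀ i j, i ≤ k → j ≤ k → f i = f j → i = j) := by
    intro k
    induction k with
    | zero => exact ⟨fun _ => y, rfl, fun j hj => by omega, fun i j _ _ _ => by omega⟩
    | succ k ih =>
      obtain ⟨f, hf0, hf, hinj⟩ := ih
      obtain ⟨hm, hne⟩ := hcon k f hf0 hf hinj
      unfold Missing at hm
      push Not at hm
      obtain ⟨w, hw⟩ := hm
      have hwne : ∀ j ≤ k, f j ≠ w := by
        rintro (_ | j) hj rfl
        · rw [hf0, h0] at hw; cases hw
        · rw [hf j hj] at hw
          exact hne j hj (Option.some.inj hw)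
      refine ⟨fun j => if j ≤ k then f j else w, by simp [hf0], ?_, ?_⟩
      · intro j hj
        rcases Nat.lt_succ_iff_lt_or_eq.1 hj with hj' | rfl
        · simpa [hj'.le, Nat.succ_le_of_lt hj'] using hf j hj'
        · simpa using hw
      · intro i j hi hj e
        dsimp only at e
        split_ifs at e with h1 h2 h2
        · exact hinj i j h1 h2 e
        · exact (hwne i h1 e).elim
        · exact (hwne j h2 e.symm).elim
        · omega
  obtain ⟨f, -, -, hinj⟩ := key (Fintype.card V)
  have : Function.Injective fun i : Fin (Fintype.card V + 1) => f i := fun i j e =>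
    Fin.ext (hinj i j (by omega) (by omega) e)
  have := Fintype.card_le_of_injective _ this
  simp at this

/-- Two alternating walks from distinct vertices cannot both end in a vertex missing the first
colour. -/
theorem ProperOn.exists_avoiding (h : ProperOn G D c) {a b : ℕ} {x v v' : V} (hx : Missing c x a)
    (hv : Missing c v b) (hv' : Missing c v' b) (hxv : x ≠ v) (hxv' : x ≠ v') (hne : v ≠ v') :
    (∀ p L, IsAlternating c a b p L → p 0 = v → ∀ t ≤ L, p t ≠ x) ∨
      ∃ q M, IsAlternating c a b q M ∧ q 0 = v ∧ q M = x ∧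
        ∀ p L, IsAlternating c a b p L → p 0 = v' → ∀ t ≤ L, p t ≠ x := by
  by_cases hcase : ∀ p L, IsAlternating c a b p L → p 0 = v → ∀ t ≤ L, p t ≠ x
  · exact Or.inl hcase
  · right
    push Not at hcase
    obtain ⟨q, M', hq, hq0, M, hM, hqM⟩ := hcase
    refine ⟨q, M, hq.mono hM, hq0, hqM, ?_⟩
    intro p L hp hp0 t ht hpt
    have arrive : ∀ (r : ℕ → V) (N s : ℕ), IsAlternating c a b r N → r 0 ≠ x → s ≤ N → r s = x →
        altColour a b s = a ∧ altColour a b (s + 1) = b := by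
      intro r N s hr hr0 hs hrs
      rcases s with _ | s
      · exact (hr0 hrs).elim
      · have := hr.prev hs
        rw [hrs] at this
        have hne : altColour a b s ≠ a := fun e => hx _ (by rw [← e]; exact this)
        rw [altColour_add_two]
        have := altColour_eq_or a b s
        grind
    have h1 := arrive p L t hp (by rw [hp0]; exact hxv'.symm) ht hpt
    have h2 := arrive q M' M hq (by rw [hq0]; exact hxv.symm) hM hqM
    have := (h.alternating_unique hp hq (by rwa [hp0]) (by rwa [hq0]) t ht M hM
      (by rw [hpt, hqM]) (by rw [h1.1, h2.1]) (by rw [h1.2, h2.2])).1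
    exact hne (by rw [← hq0, ← hp0, this])

/-- If the alternating walk from `v` reaches `x`, then an alternating walk from `v'` that avoids
`x` does not arrive at `v`. -/
theorem ProperOn.not_arrive (h : ProperOn G D c) {a b : ℕ} {x v v' : V} {p q : ℕ → V} {L M : ℕ}
    (hab : a ≠ b) (hv' : Missing c v' b) (hq : IsAlternating c a b q M) (hq0 : q 0 = v)
    (hqM : q M = x) (hp : IsAlternating c a b p L) (hp0 : p 0 = v') (hpx : ∀ t ≤ L, p t ≠ x)
    (hcol : altColour a b L = b) : p L ≠ v := by
  intro hpL
  have hL : Odd L := by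
    rw [← Nat.not_even_iff_odd]; intro he
    simp [altColour, he] at hcol; exact hab hcol
  have hr : IsAlternating c a b (fun j => p (L - j)) L := by
    intro s hs
    have := hp.prev (t := L - 1 - s) (by omega)
    have e1 : L - 1 - s + 1 = L - s := by omega
    have e2 : L - 1 - s = L - (s + 1) := by omega
    rw [e1, e2] at this
    dsimp only
    rw [this]
    congr 1
    unfold altColour
    have : Even (L - (s + 1)) ↔ Even s := by grind
    simp [this]
  have hcongr := h.alternating_congr hr hq (by simp [hpL, hq0])
  rcases le_or_gt M L with hML | hML
  · exact hpx (L - M) (by omega) (by rw [← hqM, ← hcongr M hML le_rfl])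
  · have e := hcongr L le_rfl hML.le
    have := hq L hML
    rw [← e] at this
    simp only [Nat.sub_self, hp0, hcol] at this
    exact hv' _ this

theorem ProperOn.augment_or_fan [Fintype V] (h : ProperOn G D c) {x y : V} (hxy : G.Adj x y)
    (h0 : c s(x, y) = none) (m : V → ℕ)
    (hm : ∀ v, G.Adj x v → 1 ≤ m v ∧ m v ≤ D ∧ Missing c v (m v)) :
    (∃ c', ProperOn G D c' ∧ (∀ f, c' f = none → c f = none ∧ f ≠ s(x, y)) ∧
      ∀ f, x ∉ f → c' f = c f) ∨
    ∃ δ, ¬ Missing c x δ ∧ ∀ a, Missing c x a → ∃ v c', G.Adj x v ∧ m v = δ ∧ ProperOn G D c' ∧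
      c' s(x, v) = none ∧ (∀ f, c' f = none → f = s(x, v) ∨ (c f = none ∧ f ≠ s(x, y))) ∧
      (∀ f, x ∉ f → c' f = c f) ∧ Missing c' x a ∧ Missing c' v δ ∧
      ∀ p L, IsAlternating c a δ p L → p 0 = v → (∀ t ≤ L, p t ≠ x) ∧
        (Missing c (p L) (altColour a δ L) → Missing c' (p L) (altColour a δ L)) := by
  obtain ⟨k, y, rfl, hfan, hinj, hend⟩ := exists_maximal_fan (c := c) m h0
  have hadj : ∀ j ≤ k, G.Adj x (y j) := by
    rintro (_ | j) hj
    · exact hxy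
    · exact (h.1 _ _ _ (hfan j hj)).1
  have rot : ∀ j ≤ k, ∃ c', ProperOn G D c' ∧ c' s(x, y j) = none ∧
      (∀ i < j, c' s(x, y i) = some (m (y i))) ∧
      (∀ f, (∀ i ≤ j, f ≠ s(x, y i)) → c' f = c f) ∧
      ∀ v l, (∀ i < j, v ≠ y i) → Missing c v l → Missing c' v l := fun j hj =>
    exists_rotation h h0 hxy j (fun i hi => hfan i (by omega))
      (fun i i' hi hi' => hinj i i' (by omega) (by omega))
      fun i hi => (hm _ (hadj i (by omega))).2.2
  have fresh : ∀ j ≤ k, ∀ i < j, y j ≠ y i := fun j hj i hi e => by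
    have := hinj _ _ hj (by omega) e; omega
  have star : ∀ (c' : Sym2 V → Option ℕ) j, (∀ f, (∀ i ≤ j, f ≠ s(x, y i)) → c' f = c f) →
      ∀ f, x ∉ f → c' f = c f := fun c' j hc' f hf => hc' f fun i _ e => hf (by simp [e])
  have uncoloured : ∀ (c' : Sym2 V → Option ℕ), ∀ j ≤ k,
      (∀ i < j, c' s(x, y i) = some (m (y i))) →
      (∀ f, (∀ i ≤ j, f ≠ s(x, y i)) → c' f = c f) →
      ∀ f, c' f = none → f = s(x, y j) ∨ (c f = none ∧ f ≠ s(x, y 0)) := by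
    intro c' j _ hs heq f hf
    by_cases hj : ∃ i ≤ j, f = s(x, y i)
    · obtain ⟨i, hi, rfl⟩ := hj
      rcases hi.lt_or_eq with hi' | rfl
      · rw [hs i hi'] at hf; cases hf
      · exact Or.inl rfl
    · push Not at hj
      rw [heq f hj] at hf
      exact Or.inr ⟨hf, hj 0 (Nat.zero_le _)⟩
  by_cases hmiss : Missing c x (m (y k))
  · left
    obtain ⟨c', hc', hn, hs, heq, hmiss'⟩ := rot k le_rfl
    obtain ⟨h1, h2, h3⟩ := hm _ (hadj k le_rfl)
    refine ⟨recolour c' s(x, y k) (some (m (y k))), hc'.recolour_some (hadj k le_rfl) h1 h2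
      (hmiss' _ _ (fun i hi => (hadj i hi.le).ne) hmiss) (hmiss' _ _ (fresh k le_rfl) h3), ?_, ?_⟩
    · intro f hf
      by_cases e : f = s(x, y k)
      · rw [e, recolour_self] at hf; cases hf
      · rw [recolour_of_ne _ e] at hf
        exact (uncoloured c' k le_rfl hs heq f hf).resolve_left e
    · intro f hf
      rw [recolour_of_ne _ (by rintro rfl; simp at hf), star c' k heq f hf]
  · right
    obtain ⟨i, hik, hmi⟩ := hend.resolve_left hmiss
    refine ⟨m (y k), hmiss, fun a ha => ?_⟩
    have hak : a ≠ m (y k) := by rintro rfl; exact hmiss ha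
    have hvi := (hm _ (hadj i hik.le)).2.2
    rw [hmi] at hvi
    have hvk := (hm _ (hadj k le_rfl)).2.2
    have hcoli := hfan i hik
    rw [hmi] at hcoli
    -- a colour can only be gained along an edge at `x`
    have gain : ∀ (c' : Sym2 V → Option ℕ) (p : ℕ → V) (L : ℕ), (∀ f, x ∉ f → c' f = c f) →
        Missing c' x a → p L ≠ x → Missing c (p L) (altColour a (m (y k)) L) →
        (altColour a (m (y k)) L = m (y k) → c' s(x, p L) ≠ some (m (y k))) →
        Missing c' (p L) (altColour a (m (y k)) L) := by
      intro c' p L hst hxa hpx hold hgain w hw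
      by_cases hwx : w = x
      · subst hwx
        rw [Sym2.eq_swap] at hw
        rcases altColour_eq_or a (m (y k)) L with he | he
        · rw [he.1] at hw; exact hxa _ hw
        · rw [he.1] at hw; exact hgain he.1 hw
      · rw [hst _ (by simp [hpx.symm, Ne.symm hwx])] at hw
        exact hold _ hw
    rcases h.exists_avoiding ha hvi hvk (hadj i hik.le).ne (hadj k le_rfl).ne
      (fresh k le_rfl i hik).symm with hav | ⟨q, M, hq, hq0, hqM, hav⟩
    · obtain ⟨c', hc', hn, hs, heq, hmiss'⟩ := rot i hik.le
      have hxa : Missing c' x a := hmiss' _ _ (fun j hj => (hadj j (by omega)).ne) ha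
      refine ⟨y i, c', hadj i hik.le, hmi, hc', hn, uncoloured c' i hik.le hs heq,
        star c' i heq, hxa, hmiss' _ _ (fresh i hik.le) hvi, fun p L hp hp0 =>
          ⟨hav p L hp hp0, fun hold => gain c' p L (star c' i heq) hxa (hav p L hp hp0 L le_rfl)
            hold fun hcol hg => ?_⟩⟩
      have h1 : c' s(x, y (i + 1)) = some (m (y k)) := by
        rw [heq, hcoli]
        intro j hj e
        exact fresh (i + 1) hik j (by omega) (Sym2.congr_right.1 e)
      have e := hc'.2 _ _ _ _ hg h1
      refine hold x ?_
      rw [hcol, e, Sym2.eq_swap, hcoli]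
    · obtain ⟨c', hc', hn, hs, heq, hmiss'⟩ := rot k le_rfl
      have hxa : Missing c' x a := hmiss' _ _ (fun j hj => (hadj j (by omega)).ne) ha
      refine ⟨y k, c', hadj k le_rfl, rfl, hc', hn, uncoloured c' k le_rfl hs heq,
        star c' k heq, hxa, hmiss' _ _ (fresh k le_rfl) hvk, fun p L hp hp0 =>
          ⟨hav p L hp hp0, fun hold => gain c' p L (star c' k heq) hxa (hav p L hp hp0 L le_rfl)
            hold fun hcol hg => ?_⟩⟩
      have h1 := hs i hik
      rw [hmi] at h1
      exact h.not_arrive hak hvk hq hq0 hqM hp hp0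
        (hav p L hp hp0) hcol (hc'.2 _ _ _ _ hg h1)

end Fan

section Path

variable {G : SimpleGraph V} {D : ℕ} {c : Sym2 V → Option ℕ}

/-- Shifting colours along the path `P`, the first edge of which is uncoloured. -/
theorem ProperOn.exists_shift (h : ProperOn G D c) {a b : ℕ} {P : ℕ → V} {L : ℕ}
    (hadj : G.Adj (P 0) (P 1)) (h0 : c s(P 0, P 1) = none) (ha : Missing c (P 0) a)
    (hb : Missing c (P 1) b) (hP : ∀ s < L, c s(P (s + 1), P (s + 2)) = some (altColour a b s))
    (hinj : ∀ i j, i ≤ L + 1 → j ≤ L + 1 → P i = P j → i = j) :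
    ∀ t ≤ L, ∃ c', ProperOn G D c' ∧ c' s(P t, P (t + 1)) = none ∧
      Missing c' (P t) (altColour a b t) ∧ Missing c' (P (t + 1)) (altColour a b (t + 1)) ∧
      (∀ f, (∀ j ≤ t, f ≠ s(P j, P (j + 1))) → c' f = c f) ∧
      ∀ j < t, c' s(P j, P (j + 1)) = some (altColour a b j) := by
  have hedge : ∀ i j, i ≤ L → j ≤ L → s(P i, P (i + 1)) = s(P j, P (j + 1)) → i = j := by
    intro i j hi hj e
    rw [Sym2.eq_iff] at e
    rcases e with e | e
    · exact hinj _ _ (by omega) (by omega) e.1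
    · have h1 := hinj _ _ (by omega) (by omega) e.1
      have h2 := hinj _ _ (by omega) (by omega) e.2
      omega
  intro t
  induction t with
  | zero =>
    intro _
    exact ⟨c, h, h0, by rwa [altColour_zero], by rwa [altColour_one], fun _ _ => rfl,
      fun j hj => by omega⟩
  | succ t ih =>
    intro ht
    obtain ⟨c', hc', hn, hm1, hm2, heq, hs⟩ := ih (by omega)
    have hadj' : G.Adj (P (t + 1)) (P t) := by
      rcases t with _ | t
      · exact hadj.symm
      · exact (h.1 _ _ _ (hP t (by omega))).1.symm
    have hcol : c' s(P (t + 1), P (t + 2)) = some (altColour a b t) := by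
      rw [heq, hP t (by omega)]
      intro j hj e
      have := hedge (t + 1) j ht (by omega) e
      omega
    have hne : P t ≠ P (t + 2) := fun e => by
      have := hinj _ _ (by omega) (by omega) e; omega
    have hne' : P (t + 1) ≠ P t := fun e => by
      have := hinj _ _ (by omega) (by omega) e; omega
    refine ⟨_root_.moveColour c' (P (t + 1)) (P t) (P (t + 2)), hc'.moveColour hadj' hcol hm1,
      moveColour_right _ _ _, Missing.moveColour hm2 hne', ?_, ?_, ?_⟩
    · rw [altColour_add_two]
      exact hc'.missing_moveColour hcol
    · intro f hf
      rw [moveColour_of_ne (by rw [Sym2.eq_swap]; exact hf t (by omega)) (hf (t + 1) le_rfl)]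
      exact heq f fun j hj => hf j (by omega)
    · intro j hj
      rcases Nat.lt_succ_iff_lt_or_eq.1 hj with hj' | rfl
      · rw [moveColour_of_ne, hs j hj']
        · rw [Sym2.eq_swap (a := P (t + 1))]
          intro e
          have := hedge j t (by omega) (by omega) e; omega
        · intro e
          have := hedge j (t + 1) (by omega) (by omega) e; omega
      · rw [Sym2.eq_swap, moveColour_left hne, hcol]

end Path

/-- Some uncoloured edge can be coloured by changing at most `N` edges, none of them at `S`. -/
def ShortAugmentation (G : SimpleGraph V) (D : ℕ) (c : Sym2 V → Option ℕ) (S : Finset V)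
    (N : ℕ) : Prop :=
  ∃ e c', e ∈ G.edgeSet ∧ c e = none ∧ ProperOn G D c' ∧
    (∀ f, c' f = none → c f = none ∧ f ≠ e) ∧ (∀ v ∈ S, ∀ w, c' s(v, w) = c s(v, w)) ∧
    {f | c' f ≠ c f}.ncard ≤ N

/-- `c'` colours `e` and everything coloured by `c`, except for the edge `xy`, by changing at most
`N` edges of `c`. Away from `B`, only the edges of a path `P` with colours `κ₁`, `κ₂` in `c` that
ends in `x` were changed; all vertices of `P` lie in `A` or `B`. -/
structure ChainState (G : SimpleGraph V) (D : ℕ) (c : Sym2 V → Option ℕ) (m : V → ℕ)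
    (S B A : Finset V) (N : ℕ) (x y : V) (e : Sym2 V) (c' : Sym2 V → Option ℕ) (κ₁ κ₂ : ℕ)
    (P : Set V) : Prop where
  mem_edgeSet : e ∈ G.edgeSet
  uncoloured : c e = none
  proper : ProperOn G D c'
  adj : G.Adj x y
  uncoloured' : c' s(x, y) = none
  eq_of_none : ∀ f, c' f = none → f = s(x, y) ∨ (c f = none ∧ f ≠ e)
  avoid : ∀ v ∈ S, ∀ w, c' s(v, w) = c s(v, w)
  ncard_le : {f | c' f ≠ c f}.ncard ≤ N
  changed : ∀ u w, u ∉ B → c' s(u, w) ≠ c s(u, w) → u ∈ P ∧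
    (∀ k, c' s(u, w) = some k → k = κ₁ ∨ k = κ₂) ∧
    (c s(u, w) = some κ₁ ∨ c s(u, w) = some κ₂)
  not_missing : ∀ u ∈ P, u ∉ B → ¬ Missing c u κ₁ ∧ ¬ Missing c u κ₂
  closed : ∀ u ∈ P, u ≠ x → ∀ w, c s(u, w) = some κ₁ ∨ c s(u, w) = some κ₂ → w ∈ P
  subset : ∀ u ∈ P, u ∈ A ∨ u ∈ B
  missing : Missing c' x κ₁
  colours : κ₂ = 0 ∨ (1 ≤ κ₁ ∧ κ₁ ≤ D ∧ κ₁ ≠ κ₂)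
  ne_left : m x ≠ κ₁
  ne_right : m x ≠ κ₂

section Chain

variable {G : SimpleGraph V} {D : ℕ} {c : Sym2 V → Option ℕ}

theorem ncard_changed_trans [Finite V] (c c' c'' : Sym2 V → Option ℕ) :
    {f | c'' f ≠ c f}.ncard ≤ {f | c' f ≠ c f}.ncard + {f | c'' f ≠ c' f}.ncard := by
  refine (Set.ncard_le_ncard (fun f hf => ?_) (Set.toFinite _)).trans (Set.ncard_union_le _ _)
  simp only [Set.mem_ofPred_eq, Set.mem_union] at hf ⊢
  by_contra hcon
  push Not at hcon
  exact hf (hcon.2.trans hcon.1)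

theorem ncard_changed_star_le [Fintype V] [DecidableRel G.Adj] {c' : Sym2 V → Option ℕ} {x : V}
    (hD : ∀ v, G.degree v < D) (h : ProperOn G D c) (h' : ProperOn G D c')
    (hx : ∀ f, x ∉ f → c' f = c f) : {f | c' f ≠ c f}.ncard ≤ D := by
  classical
  have hsub : {f | c' f ≠ c f} ⊆ ((G.neighborFinset x).image fun w => s(x, w) : Finset (Sym2 V)) := by
    intro f hf
    have hxf : x ∈ f := by
      by_contra hxf; exact hf (hx f hxf)
    obtain ⟨w, rfl⟩ := hxf
    simp only [Finset.coe_image, Set.mem_image, Finset.mem_coe, mem_neighborFinset]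
    refine ⟨w, ?_, rfl⟩
    simp only [Set.mem_ofPred_eq] at hf
    rcases h1 : c' s(x, w) with _ | k
    · rcases h2 : c s(x, w) with _ | k
      · exact (hf (h1.trans h2.symm)).elim
      · exact (h.1 _ _ _ h2).1
    · exact (h'.1 _ _ _ h1).1
  calc _ ≤ _ := Set.ncard_le_ncard hsub (Finset.finite_toSet _)
    _ ≤ (G.neighborFinset x).card := by rw [Set.ncard_coe_finset]; exact Finset.card_image_le
    _ ≤ D := by rw [card_neighborFinset_eq_degree]; exact (hD x).le

theorem ncard_changed_path_le {c' : Sym2 V → Option ℕ} {P : ℕ → V} {t : ℕ}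
    (h : ∀ f, (∀ j ≤ t, f ≠ s(P j, P (j + 1))) → c' f = c f) :
    {f | c' f ≠ c f}.ncard ≤ t + 1 := by
  classical
  have hsub : {f | c' f ≠ c f} ⊆
      ((Finset.range (t + 1)).image fun j => s(P j, P (j + 1)) : Finset (Sym2 V)) := by
    intro f hf
    by_contra hcon
    refine hf (h f fun j hj e => hcon ?_)
    simp only [Finset.coe_image, Set.mem_image, Finset.mem_coe, Finset.mem_range]
    exact ⟨j, by omega, e.symm⟩
  calc _ ≤ _ := Set.ncard_le_ncard hsub (Finset.finite_toSet _)
    _ ≤ (Finset.range (t + 1)).card := by rw [Set.ncard_coe_finset]; exact Finset.card_image_le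
    _ = t + 1 := Finset.card_range _

theorem ShortAugmentation.mono {S : Finset V} {N N' : ℕ} (h : ShortAugmentation G D c S N)
    (hN : N ≤ N') : ShortAugmentation G D c S N' := by
  obtain ⟨e, c', h1, h2, h3, h4, h5, h6⟩ := h
  exact ⟨e, c', h1, h2, h3, h4, h5, h6.trans hN⟩

variable {m : V → ℕ} {S B A : Finset V} {N : ℕ} {x y : V} {e : Sym2 V} {c' : Sym2 V → Option ℕ}
  {κ₁ κ₂ : ℕ} {P : Set V}

theorem ChainState.missing_of_notMem (hs : ChainState G D c m S B A N x y e c' κ₁ κ₂ P)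
    (hm : ∀ v, 1 ≤ m v ∧ m v ≤ D ∧ Missing c v (m v)) {v : V} (hv : v ∉ B) :
    Missing c' v (m v) := by
  intro w hw
  by_cases hc : c' s(v, w) = c s(v, w)
  · exact (hm v).2.2 w (hc ▸ hw)
  · obtain ⟨hP, hk, -⟩ := hs.changed v w hv hc
    have := hs.not_missing v hP hv
    rcases hk _ hw with hk | hk
    · exact this.1 (hk ▸ (hm v).2.2)
    · exact this.2 (hk ▸ (hm v).2.2)

/-- The walk that continues a chain may be computed in the original colouring. -/
theorem ChainState.transfer (hs : ChainState G D c m S B A N x y e c' κ₁ κ₂ P) {δ a : ℕ} {v : V}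
    (hv : Missing c v δ) (hcase : (δ ≠ κ₁ ∧ δ ≠ κ₂ ∧ a ≠ κ₁ ∧ a ≠ κ₂) ∨ (δ = κ₂ ∧ a = κ₁))
    (hfan : ∀ p L, IsAlternating c' a δ p L → p 0 = v → ∀ t ≤ L, p t ≠ x) {p : ℕ → V} {L : ℕ}
    (hp : IsAlternating c a δ p L) (hp0 : p 0 = v) (hB : ∀ t ≤ L, p t ∉ B) :
    IsAlternating c' a δ p L ∧
      (Missing c (p L) (altColour a δ L) → Missing c' (p L) (altColour a δ L)) := by
  rcases hcase with ⟨h1, h2, h3, h4⟩ | ⟨rfl, rfl⟩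
  · have hne : ∀ s, altColour a δ s ≠ κ₁ ∧ altColour a δ s ≠ κ₂ := fun s => by
      have := altColour_eq_or a δ s; grind
    constructor
    · intro s hsL
      by_contra hcon
      have hc := hp s hsL
      have := (hs.changed (p s) (p (s + 1)) (hB s hsL.le) (by rw [hc]; exact hcon)).2.2
      have := hne s
      grind
    · intro hm w hw
      by_cases hc : c' s(p L, w) = c s(p L, w)
      · exact hm w (hc ▸ hw)
      · have := (hs.changed _ _ (hB L le_rfl) hc).2.1 _ hw
        have := hne L
        tauto
  · have key : ∀ s ≤ L, IsAlternating c' a δ p s ∧ p s ∉ P := by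
      intro s
      induction s with
      | zero =>
        intro _
        refine ⟨fun s hs => by omega, fun hP => ?_⟩
        exact (hs.not_missing _ hP (hB 0 (Nat.zero_le _))).2 (hp0 ▸ hv)
      | succ s ih =>
        intro hsL
        obtain ⟨h1, h2⟩ := ih (by omega)
        have hc := hp s hsL
        have h3 : IsAlternating c' a δ p (s + 1) := by
          intro j hj
          rcases Nat.lt_succ_iff_lt_or_eq.1 hj with hj' | rfl
          · exact h1 j hj'
          · by_contra hcon
            exact h2 (hs.changed _ (p (j + 1)) (hB j (by omega)) (by rw [hc]; exact hcon)).1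
        refine ⟨h3, fun hP => h2 ?_⟩
        refine hs.closed _ hP (hfan p _ h3 hp0 _ le_rfl) _ ?_
        rw [Sym2.eq_swap, hc]
        have := altColour_eq_or a δ s; grind
    refine ⟨(key L le_rfl).1, fun hm w hw => ?_⟩
    by_cases hc : c' s(p L, w) = c s(p L, w)
    · exact hm w (hc ▸ hw)
    · exact (key L le_rfl).2 (hs.changed _ _ (hB L le_rfl) hc).1

/-- Rotating the fan at the end of a chain. -/
theorem ChainState.exists_fan [Fintype V] [DecidableRel G.Adj]
    (hs : ChainState G D c m S B A N x y e c' κ₁ κ₂ P) (hD : ∀ v, G.degree v < D)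
    (hm : ∀ v, 1 ≤ m v ∧ m v ≤ D ∧ Missing c v (m v)) (hSB : S ⊆ B)
    (hx : x ∉ B) (hxn : ∀ v, G.Adj x v → v ∉ B) :
    ShortAugmentation G D c S (N + D) ∨
    ∃ δ a v c'', G.Adj x v ∧ a ≠ δ ∧ 1 ≤ δ ∧ δ ≤ D ∧ 1 ≤ a ∧ a ≤ D ∧ Missing c v δ ∧
      ProperOn G D c'' ∧ c'' s(x, v) = none ∧
      (∀ f, c'' f = none → f = s(x, v) ∨ (c f = none ∧ f ≠ e)) ∧
      (∀ v ∈ S, ∀ w, c'' s(v, w) = c s(v, w)) ∧ {f | c'' f ≠ c f}.ncard ≤ N + D ∧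
      (∀ u w, u ∉ B → u ∉ A → u ≠ x → ¬ G.Adj x u → c'' s(u, w) = c s(u, w)) ∧
      Missing c'' x a ∧ Missing c'' v δ ∧
      ∀ p L, IsAlternating c a δ p L → p 0 = v → (∀ t ≤ L, p t ∉ B) →
        (∀ t ≤ L, p t ≠ x) ∧ IsAlternating c'' a δ p L ∧
        (Missing c (p L) (altColour a δ L) → Missing c'' (p L) (altColour a δ L)) := by
  have hmx : Missing c' x (m x) := hs.missing_of_notMem hm hx
  have star : ∀ c'' : Sym2 V → Option ℕ, ProperOn G D c'' → (∀ f, x ∉ f → c'' f = c' f) →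
      ∀ u w, u ≠ x → ¬ G.Adj x u → c'' s(u, w) = c' s(u, w) := by
    intro c'' hc'' hst u w hux hadj
    by_cases hwx : w = x
    · subst hwx
      have none_of : ∀ d : Sym2 V → Option ℕ, ProperOn G D d → d s(u, w) = none := by
        intro d hd
        rcases h1 : d s(u, w) with _ | k
        · rfl
        · exact (hadj (hd.1 _ _ _ h1).1.symm).elim
      rw [none_of _ hc'', none_of _ hs.proper]
    · exact hst _ (by simp [hux.symm, Ne.symm hwx])
  have avoid : ∀ c'' : Sym2 V → Option ℕ, ProperOn G D c'' → (∀ f, x ∉ f → c'' f = c' f) →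
      ∀ v ∈ S, ∀ w, c'' s(v, w) = c s(v, w) := by
    intro c'' hc'' hst v hv w
    rw [star c'' hc'' hst v w, hs.avoid v hv]
    · rintro rfl; exact hx (hSB hv)
    · intro hadj; exact hxn v hadj (hSB hv)
  have count : ∀ c'' : Sym2 V → Option ℕ, ProperOn G D c'' → (∀ f, x ∉ f → c'' f = c' f) →
      {f | c'' f ≠ c f}.ncard ≤ N + D := fun c'' hc'' hst =>
    (ncard_changed_trans c c' c'').trans
      (add_le_add hs.ncard_le (ncard_changed_star_le hD hs.proper hc'' hst))
  have trace : ∀ f, c' f = none ∧ f ≠ s(x, y) → c f = none ∧ f ≠ e :=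
    fun f hf => (hs.eq_of_none f hf.1).resolve_left hf.2
  rcases hs.proper.augment_or_fan hs.adj hs.uncoloured' m
    (fun v hv => ⟨(hm v).1, (hm v).2.1, hs.missing_of_notMem hm (hxn v hv)⟩) with
    ⟨c'', hc'', hn, hst⟩ | ⟨δ, hδ, hfan⟩
  · left
    exact ⟨e, c'', hs.mem_edgeSet, hs.uncoloured, hc'', fun f hf => trace f (hn f hf),
      avoid c'' hc'' hst, count c'' hc'' hst⟩
  · right
    have hδ₁ : δ ≠ κ₁ := by rintro rfl; exact hδ hs.missing
    obtain ⟨a, ha, ha1, haD, hcase⟩ : ∃ a, Missing c' x a ∧ 1 ≤ a ∧ a ≤ D ∧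
        ((δ ≠ κ₁ ∧ δ ≠ κ₂ ∧ a ≠ κ₁ ∧ a ≠ κ₂) ∨ (δ = κ₂ ∧ a = κ₁)) := by
      by_cases h2 : δ = κ₂
      · have hδ0 : δ ≠ 0 := by
          rintro rfl
          refine hδ fun w hw => ?_
          have := (hs.proper.1 _ _ _ hw).2.1
          omega
        obtain ⟨h3, h4, -⟩ := hs.colours.resolve_left (h2 ▸ hδ0)
        exact ⟨κ₁, hs.missing, h3, h4, Or.inr ⟨h2, rfl⟩⟩
      · exact ⟨m x, hmx, (hm x).1, (hm x).2.1, Or.inl ⟨hδ₁, h2, hs.ne_left, hs.ne_right⟩⟩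
    obtain ⟨v, c'', hxv, rfl, hc'', hn, hnone, hst, hxa, hvδ, hwalk⟩ := hfan a ha
    refine ⟨m v, a, v, c'', hxv, by rintro rfl; exact hδ ha, (hm v).1, (hm v).2.1, ha1, haD,
      (hm v).2.2, hc'', hn, fun f hf => (hnone f hf).imp_right (trace f),
      avoid c'' hc'' hst, count c'' hc'' hst, ?_, hxa, hvδ, ?_⟩
    · intro u w huB huA hux hadj
      rw [star c'' hc'' hst u w hux hadj]
      by_contra hcon
      rcases hs.subset u (hs.changed u w huB hcon).1 with h | h
      · exact huA h
      · exact huB h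
    · intro p L hp hp0 hB
      obtain ⟨h1, h2⟩ := hs.transfer (hm v).2.2 hcase (fun p L hp hp0 => (hwalk p L hp hp0).1)
        hp hp0 hB
      obtain ⟨h3, h4⟩ := hwalk p L h1 hp0
      refine ⟨h3, fun s hsL => ?_, fun hmiss => h4 (h2 hmiss)⟩
      rw [hst _ (by simp [(h3 s hsL.le).symm, (h3 (s + 1) hsL).symm]), h1 s hsL]

/-- Continuing a chain along an alternating path that avoids `B`. -/
theorem ChainState.step [Fintype V] [DecidableRel G.Adj]
    (hs : ChainState G D c m S B A N x y e c' κ₁ κ₂ P) (hc : ProperOn G D c)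
    (hD : ∀ v, G.degree v < D) (hm : ∀ v, 1 ≤ m v ∧ m v ≤ D ∧ Missing c v (m v)) (hSB : S ⊆ B)
    (hx : x ∉ B) (hxn : ∀ v, G.Adj x v → v ∉ B) :
    ShortAugmentation G D c S (N + D) ∨
    ∃ δ a v, G.Adj x v ∧ a ≠ δ ∧ 1 ≤ δ ∧ δ ≤ D ∧ 1 ≤ a ∧ a ≤ D ∧ Missing c v δ ∧
      ∀ p L, IsAlternating c a δ p L → p 0 = v → (∀ t ≤ L, p t ∉ B) →
        (Missing c (p L) (altColour a δ L) → ShortAugmentation G D c S (N + D + (L + 1))) ∧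
        ∀ t, 1 ≤ t → t + 1 < L → ∀ A' B' : Finset V, B ⊆ B' → A ⊆ B' → x ∈ B' →
          (∀ u, G.Adj x u → u ∈ B') → p 1 ∈ B' → (∀ s, 2 ≤ s → s < L → p s ∈ A') →
          ∃ c₃ κ κ' Q,
            ChainState G D c m S B' A' (N + D + (L + 1)) (p (t + 1)) (p t) e c₃ κ κ' Q := by
  refine (hs.exists_fan hD hm hSB hx hxn).imp_right ?_
  rintro ⟨δ, a, v, c'', hxv, haδ, hδ1, hδD, ha1, haD, hvδ, hc'', hn, hnone, hav, hcount, hout,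
    hxa, hvδ'', hwalk⟩
  refine ⟨δ, a, v, hxv, haδ, hδ1, hδD, ha1, haD, hvδ, ?_⟩
  intro p L hp hp0 hB
  obtain ⟨hpx, hp'', hstuck⟩ := hwalk p L hp hp0 hB
  have hpinj := hc.alternating_injective haδ hp (hp0 ▸ hvδ)
  have hcol1 : ∀ s, 1 ≤ altColour a δ s := fun s => by have := altColour_eq_or a δ s; omega
  have hcolD : ∀ s, altColour a δ s ≤ D := fun s => by have := altColour_eq_or a δ s; omega
  let Q : ℕ → V := fun s => Nat.casesOn s x p
  have hQ0 : Q 0 = x := rfl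
  have hQs : ∀ s, Q (s + 1) = p s := fun _ => rfl
  have hQ1 : Q 1 = p 0 := rfl
  have hQinj : ∀ i j, i ≤ L + 1 → j ≤ L + 1 → Q i = Q j → i = j := by
    have aux : ∀ i j, i < j → j ≤ L + 1 → Q i ≠ Q j := by
      rintro (_ | i) (_ | j) hij hj e
      · omega
      · exact hpx j (by omega) e.symm
      · omega
      · exact hpinj j (by omega) i (by omega) e
    intro i j hi hj e
    rcases Nat.lt_trichotomy i j with h | h | h
    · exact (aux i j h hj e).elim
    · exact h
    · exact (aux j i h hi e.symm).elim
  have hQadj : ∀ s ≤ L, G.Adj (Q s) (Q (s + 1)) := by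
    rintro (_ | s) hsL
    · rw [hQ0, hQs, hp0]; exact hxv
    · exact (hc.1 _ _ _ (hp s hsL)).1
  have hshift := hc''.exists_shift (P := Q) (L := L) (hQadj 0 (Nat.zero_le _))
    (by rw [hQ0, hQ1, hp0]; exact hn) hxa (by rw [hQ1, hp0]; exact hvδ'') hp'' hQinj
  have ncard_shift : ∀ t ≤ L, ∀ c₃ : Sym2 V → Option ℕ,
      (∀ f, (∀ j ≤ t, f ≠ s(Q j, Q (j + 1))) → c₃ f = c'' f) →
      {f | c₃ f ≠ c f}.ncard ≤ N + D + (L + 1) := fun t ht c₃ h =>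
    (ncard_changed_trans c c'' c₃).trans
      (add_le_add hcount ((ncard_changed_path_le h).trans (by omega)))
  have hQS : ∀ j ≤ L + 1, Q j ∉ S := by
    rintro (_ | j) hj hjS
    · exact hx (hSB hjS)
    · exact hB j (by omega) (hSB hjS)
  have avoid_shift : ∀ t ≤ L, ∀ c₃ : Sym2 V → Option ℕ,
      (∀ f, (∀ j ≤ t, f ≠ s(Q j, Q (j + 1))) → c₃ f = c'' f) →
      ∀ v ∈ S, ∀ w, c₃ s(v, w) = c s(v, w) := by
    intro t ht c₃ h v hv w
    rw [h, hav v hv]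
    intro j hj e
    rw [Sym2.eq_iff] at e
    rcases e with e | e
    · exact hQS j (by omega) (e.1 ▸ hv)
    · exact hQS (j + 1) (by omega) (e.1 ▸ hv)
  have none_shift : ∀ t ≤ L, ∀ c₃ : Sym2 V → Option ℕ,
      (∀ f, (∀ j ≤ t, f ≠ s(Q j, Q (j + 1))) → c₃ f = c'' f) →
      (∀ j < t, c₃ s(Q j, Q (j + 1)) = some (altColour a δ j)) →
      ∀ f, c₃ f = none → f = s(Q t, Q (t + 1)) ∨ (c f = none ∧ f ≠ e) := by
    intro t ht c₃ h h' f hf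
    by_cases hcase : ∃ j ≤ t, f = s(Q j, Q (j + 1))
    · obtain ⟨j, hj, rfl⟩ := hcase
      rcases hj.lt_or_eq with hj' | rfl
      · rw [h' j hj'] at hf; cases hf
      · exact Or.inl rfl
    · push Not at hcase
      rw [h f hcase] at hf
      refine (hnone f hf).imp_left fun e => (hcase 0 (Nat.zero_le _) ?_).elim
      rw [hQ0, hQs, hp0, e]
  constructor
  · intro hend
    obtain ⟨c₃, hc₃, hn₃, hm1, -, heq, hcol⟩ := hshift L le_rfl
    have hm2 : Missing c₃ (Q (L + 1)) (altColour a δ L) := by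
      intro w hw
      by_cases hf : ∃ j ≤ L, s(Q (L + 1), w) = s(Q j, Q (j + 1))
      · obtain ⟨j, hj, hf⟩ := hf
        have hjL : j = L := by
          rw [Sym2.eq_iff] at hf
          rcases hf with hf | hf
          · have := hQinj (L + 1) j le_rfl (by omega) hf.1; omega
          · have := hQinj (L + 1) (j + 1) le_rfl (by omega) hf.1; omega
        rw [hf, hjL, hn₃] at hw
        cases hw
      · push Not at hf
        rw [heq _ hf] at hw
        exact hstuck hend w hw
    refine ⟨e, recolour c₃ s(Q L, Q (L + 1)) (some (altColour a δ L)), hs.mem_edgeSet,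
      hs.uncoloured, hc₃.recolour_some (hQadj L le_rfl) (hcol1 L) (hcolD L) hm1 hm2, ?_, ?_, ?_⟩
    · intro f hf
      by_cases e' : f = s(Q L, Q (L + 1))
      · rw [e', recolour_self] at hf; cases hf
      · rw [recolour_of_ne _ e'] at hf
        exact (none_shift L le_rfl c₃ heq hcol f hf).resolve_left e'
    · refine avoid_shift L le_rfl _ fun f hf => ?_
      rw [recolour_of_ne _ (hf L le_rfl), heq f hf]
    · refine ncard_shift L le_rfl _ fun f hf => ?_
      rw [recolour_of_ne _ (hf L le_rfl), heq f hf]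
  · intro t ht1 htL A' B' hBB' hAB' hxB' hxnB' hp1 hpA'
    obtain ⟨c₃, hc₃, hn₃, hm1, hm2, heq, hcol⟩ := hshift (t + 1) (by omega)
    have both : ∀ s, 1 ≤ s → s < L → ∀ i, ¬ Missing c (p s) (altColour a δ i) := by
      intro s hs1 hsL i hmiss
      obtain ⟨s, rfl⟩ : ∃ r, s = r + 1 := ⟨s - 1, by omega⟩
      rcases altColour_mem_pair a δ i s with e | e
      · exact hmiss _ (by rw [e]; exact hp.prev hsL.le)
      · exact hmiss _ (by rw [e]; exact hp _ hsL)
    have hp0B' : p 0 ∈ B' := hp0 ▸ hxnB' v hxv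
    have hp2 : ∀ s ≤ t + 1, p s ∉ B' → 2 ≤ s := by
      rintro (_ | _ | s) _ h
      · exact (h hp0B').elim
      · exact (h hp1).elim
      · omega
    refine ⟨c₃, altColour a δ (t + 2), altColour a δ (t + 1), {u | ∃ s ≤ t + 1, u = p s}, ?_⟩
    constructor
    · exact hs.mem_edgeSet
    · exact hs.uncoloured
    · exact hc₃
    · exact (hQadj (t + 1) (by omega)).symm
    · rw [Sym2.eq_swap]; exact hn₃
    · intro f hf
      rw [Sym2.eq_swap]
      exact none_shift (t + 1) (by omega) c₃ heq hcol f hf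
    · exact avoid_shift (t + 1) (by omega) c₃ heq
    · exact ncard_shift (t + 1) (by omega) c₃ heq
    · intro u w hu hcw
      have hcu : c'' s(u, w) = c s(u, w) :=
        hout u w (fun h => hu (hBB' h)) (fun h => hu (hAB' h)) (by rintro rfl; exact hu hxB')
          fun h => hu (hxnB' u h)
      rw [← hcu] at hcw ⊢
      have hf : ∃ j ≤ t + 1, s(u, w) = s(Q j, Q (j + 1)) := by
        by_contra hf
        push Not at hf
        exact hcw (heq _ hf)
      obtain ⟨j, hj, hf⟩ := hf
      rcases j with _ | j
      · rw [Sym2.eq_iff, hQs, hQ0] at hf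
        rcases hf with hf | hf
        · exact (hu (hf.1 ▸ hxB')).elim
        · exact (hu (hf.1 ▸ hp0B')).elim
      · refine ⟨?_, ?_, ?_⟩
        · rw [Sym2.eq_iff, hQs, hQs] at hf
          rcases hf with hf | hf
          · exact ⟨j, by omega, hf.1⟩
          · exact ⟨j + 1, by omega, hf.1⟩
        · intro k hk
          rw [hf] at hk
          rcases hj.lt_or_eq with hj' | hj'
          · rw [hcol _ hj'] at hk
            cases hk
            exact (altColour_mem_pair a δ (j + 1) (t + 1)).symm
          · rw [hj', hn₃] at hk; cases hk
        · rw [hf, hQs, hQs, hp'' j (by omega)]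
          simp only [Option.some.injEq]
          exact (altColour_mem_pair a δ j (t + 1)).symm
    · rintro u ⟨s, hs', rfl⟩ hu
      have := hp2 s hs' hu
      exact ⟨both s (by omega) (by omega) _, both s (by omega) (by omega) _⟩
    · rintro u ⟨s, hs', rfl⟩ hu w hw
      have hst : s < t + 1 := hs'.lt_of_ne (by rintro rfl; exact hu rfl)
      have hw' : c s(p s, w) = some (altColour a δ s) ∨
          c s(p s, w) = some (altColour a δ (s + 1)) := by
        have h1 := altColour_mem_pair a δ (t + 1) s
        have h2 := altColour_mem_pair a δ (t + 2) s
        rcases hw with hw | hw <;> rw [hw] <;> simpa only [Option.some.injEq]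
      rcases hw' with hw' | hw'
      · exact ⟨s + 1, hst, hc.2 _ _ _ _ hw' (hp s (by omega))⟩
      · rcases s with _ | s
        · rw [hp0, altColour_one] at hw'
          exact (hvδ _ hw').elim
        · rw [altColour_add_two] at hw'
          exact ⟨s, by omega, hc.2 _ _ _ _ hw' (hp.prev (by omega))⟩
    · rintro u ⟨s, hs', rfl⟩
      by_cases hu : p s ∈ B'
      · exact Or.inr hu
      · exact Or.inl (hpA' s (hp2 s hs' hu) (by omega))
    · exact hm2
    · exact Or.inr ⟨hcol1 _, hcolD _, (altColour_ne_succ haδ (t + 1)).symm⟩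
    · intro h
      exact both (t + 1) (by omega) htL (t + 2) (h ▸ (hm _).2.2)
    · intro h
      exact both (t + 1) (by omega) htL (t + 1) (h ▸ (hm _).2.2)

/-- Few alternating walks with starting points next to different vertices visit a given set. -/
theorem ProperOn.card_visits_le [Fintype V] [DecidableEq V] [DecidableRel G.Adj]
    (hc : ProperOn G D c) (hD : ∀ v, G.degree v < D) {a δ L : V → ℕ} {p : V → ℕ → V}
    (R : Finset (V × ℕ)) (Y : Finset V)
    (hR : ∀ q ∈ R, G.Adj q.1 (p q.1 0) ∧ Missing c (p q.1 0) (δ q.1) ∧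
      (1 ≤ a q.1 ∧ a q.1 ≤ D ∧ 1 ≤ δ q.1 ∧ δ q.1 ≤ D) ∧
      IsAlternating c (a q.1) (δ q.1) (p q.1) (L q.1) ∧ q.2 ≤ L q.1 ∧ p q.1 q.2 ∈ Y) :
    R.card ≤ D ^ 3 * Y.card := by
  let φ : V × ℕ → V × ℕ × ℕ := fun q => (p q.1 q.2, altColour (a q.1) (δ q.1) q.2,
    altColour (a q.1) (δ q.1) (q.2 + 1))
  have hmaps : ∀ q ∈ R, φ q ∈ Y ×ˢ Finset.Icc 1 D ×ˢ Finset.Icc 1 D := by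
    intro q hq
    obtain ⟨-, -, h, -, -, hY⟩ := hR q hq
    have := altColour_eq_or (a q.1) (δ q.1) q.2
    simp only [φ, Finset.mem_product, Finset.mem_Icc]
    refine ⟨hY, ?_, ?_⟩ <;> omega
  have hfib : ∀ z ∈ Y ×ˢ Finset.Icc 1 D ×ˢ Finset.Icc 1 D, (R.filter fun q => φ q = z).card ≤ D := by
    intro z _
    rcases (R.filter fun q => φ q = z).eq_empty_or_nonempty with h | ⟨q₀, hq₀⟩
    · rw [h]; simp
    · have huniq : ∀ q ∈ R.filter (fun q => φ q = z), p q.1 0 = p q₀.1 0 ∧ q.2 = q₀.2 := by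
        intro q hq
        rw [Finset.mem_filter] at hq hq₀
        obtain ⟨-, h1, -, h2, h3, -⟩ := hR q hq.1
        obtain ⟨-, h1', -, h2', h3', -⟩ := hR q₀ hq₀.1
        have e := hq.2.trans hq₀.2.symm
        simp only [φ, Prod.mk.injEq] at e
        exact hc.alternating_unique h2 h2' h1 h1' _ h3 _ h3' e.1 e.2.1 e.2.2
      calc _ ≤ (G.neighborFinset (p q₀.1 0)).card := by
            refine Finset.card_le_card_of_injOn Prod.fst ?_ ?_
            · intro q hq
              rw [Finset.mem_coe] at hq ⊢
              rw [mem_neighborFinset, ← (huniq q hq).1]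
              exact (hR q (Finset.mem_filter.1 hq).1).1.symm
            · intro q hq q' hq' e
              exact Prod.ext e ((huniq q hq).2.trans (huniq q' hq').2.symm)
        _ ≤ D := by rw [card_neighborFinset_eq_degree]; exact (hD _).le
  have := Finset.card_le_mul_card_image_of_maps_to hmaps D hfib
  simp only [Finset.card_product, Nat.card_Icc, Nat.add_sub_cancel] at this
  calc _ ≤ _ := this
    _ = _ := by ring

theorem exists_next_level [Fintype V] [DecidableEq V] [DecidableRel G.Adj]
    (hc : ProperOn G D c) (hD : ∀ v, G.degree v < D)
    (hm : ∀ v, 1 ≤ m v ∧ m v ≤ D ∧ Missing c v (m v)) (hSB : S ⊆ B)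
    (hA : ∀ x ∈ A, ∃ y e c' κ₁ κ₂ P, ChainState G D c m S B A N x y e c' κ₁ κ₂ P) (T : ℕ) :
    ShortAugmentation G D c S (N + D + (T + 3)) ∨
    ∃ A' B' : Finset V, S ⊆ B' ∧ B'.card ≤ B.card + (D + 1) * A.card ∧
      A.card * T ≤ D ^ 3 * A'.card + (D + D ^ 3) * B.card * T ∧
      ∀ x ∈ A', ∃ y e c' κ₁ κ₂ P,
        ChainState G D c m S B' A' (N + D + (T + 3)) x y e c' κ₁ κ₂ P := by
  rcases A.eq_empty_or_nonempty with rfl | ⟨x₀, -⟩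
  · exact Or.inr ⟨∅, B, hSB, by simp, by simp, by simp⟩
  by_cases haug : ShortAugmentation G D c S (N + D + (T + 3))
  · exact Or.inl haug
  right
  have : Nonempty V := ⟨x₀⟩
  let near : Finset V := B.biUnion fun v => insert v (G.neighborFinset v)
  have hnear : ∀ x, x ∉ near → x ∉ B ∧ ∀ v, G.Adj x v → v ∉ B := by
    intro x hx
    simp only [near, Finset.mem_biUnion, Finset.mem_insert, mem_neighborFinset] at hx
    push Not at hx
    exact ⟨fun h => (hx x h).1 rfl, fun v hv h => (hx v h).2 hv.symm⟩
  have hnbr : ∀ v, (insert v (G.neighborFinset v)).card ≤ D := by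
    intro v
    refine (Finset.card_insert_le _ _).trans ?_
    rw [card_neighborFinset_eq_degree]; exact hD v
  have hnearcard : near.card ≤ D * B.card := by
    rw [mul_comm]; exact Finset.card_biUnion_le_card_mul _ _ _ fun v _ => hnbr v
  have hstep : ∀ x ∈ A, x ∉ near → ∃ (a δ L : ℕ) (p : ℕ → V),
      G.Adj x (p 0) ∧ Missing c (p 0) δ ∧ (1 ≤ a ∧ a ≤ D ∧ 1 ≤ δ ∧ δ ≤ D) ∧
      IsAlternating c a δ p L ∧ ((∃ t ≤ L, p t ∈ B) ∨ (L = T + 2 ∧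
        ∀ t, 1 ≤ t → t + 1 < L → ∀ A' B' : Finset V, B ⊆ B' → A ⊆ B' → x ∈ B' →
          (∀ u, G.Adj x u → u ∈ B') → p 1 ∈ B' → (∀ s, 2 ≤ s → s < L → p s ∈ A') →
          ∃ y e c₃ κ κ' Q,
            ChainState G D c m S B' A' (N + D + (T + 3)) (p (t + 1)) y e c₃ κ κ' Q)) := by
    intro x hxA hx
    obtain ⟨hxB, hxn⟩ := hnear x hx
    obtain ⟨y, e, c', κ₁, κ₂, P, hs⟩ := hA x hxA
    obtain ⟨δ, a, v, hxv, -, hδ1, hδD, ha1, haD, hvδ, hwalk⟩ :=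
      (hs.step hc hD hm hSB hxB hxn).resolve_left fun h => haug (h.mono (by omega))
    obtain ⟨p, L, hp0, hL, hp, hend⟩ := exists_alternating c a δ v (T + 2)
    refine ⟨a, δ, L, p, hp0 ▸ hxv, hp0 ▸ hvδ, ⟨ha1, haD, hδ1, hδD⟩, hp, ?_⟩
    by_cases hB : ∃ t ≤ L, p t ∈ B
    · exact Or.inl hB
    · push Not at hB
      obtain ⟨h1, h2⟩ := hwalk p L hp hp0 hB
      obtain rfl := hend.resolve_right fun h => haug ((h1 h).mono (by omega))
      refine Or.inr ⟨rfl, fun t ht1 htL A' B' i1 i2 i3 i4 i5 i6 => ?_⟩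
      obtain ⟨c₃, κ, κ', Q, h3⟩ := h2 t ht1 htL A' B' i1 i2 i3 i4 i5 i6
      exact ⟨_, _, _, _, _, _, h3⟩
  choose! a δ L p hpx using hstep
  let far := A \ near
  have hfar : ∀ x ∈ far, x ∈ A ∧ x ∉ near := fun x hx => Finset.mem_sdiff.1 hx
  let hit := far.filter fun x => ∃ t ≤ L x, p x t ∈ B
  let free := far.filter fun x => ¬ ∃ t ≤ L x, p x t ∈ B
  have hsplit : A.card ≤ near.card + (hit.card + free.card) := by
    rw [Finset.card_filter_add_card_filter_not]
    exact (Finset.card_le_card fun x hx => by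
      simp only [Finset.mem_union, far, Finset.mem_sdiff]; tauto).trans
        (Finset.card_union_le near far)
  have hitcard : hit.card ≤ D ^ 3 * B.card := by
    have htime : ∀ x ∈ hit, ∃ t, t ≤ L x ∧ p x t ∈ B := fun x hx => (Finset.mem_filter.1 hx).2
    choose! τ hτ using htime
    rw [← Finset.card_image_of_injective hit (f := fun x => (x, τ x))
      fun x y e => (Prod.mk.inj e).1]
    refine hc.card_visits_le hD (a := a) (δ := δ) (L := L) (p := p) _ _ fun q hq => ?_
    obtain ⟨x, hx, rfl⟩ := Finset.mem_image.1 hq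
    obtain ⟨hxA, hxn⟩ := hfar x (Finset.mem_filter.1 hx).1
    obtain ⟨h1, h2, h3, h4, -⟩ := hpx x hxA hxn
    exact ⟨h1, h2, h3, h4, hτ x hx⟩
  have hfree : ∀ x ∈ free, x ∈ A ∧ _ ∧ _ ∧ _ ∧ _ ∧ _ := fun x hx => by
    obtain ⟨hxA, hxn⟩ := hfar x (Finset.mem_filter.1 hx).1
    obtain ⟨h1, h2, h3, h4, h5⟩ := hpx x hxA hxn
    exact ⟨hxA, h1, h2, h3, h4, h5.resolve_left (Finset.mem_filter.1 hx).2⟩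
  let A' := (free ×ˢ Finset.Icc 2 (T + 1)).image fun q => p q.1 q.2
  let B' := B ∪ A.biUnion fun x => insert (p x 1) (insert x (G.neighborFinset x))
  refine ⟨A', B', hSB.trans Finset.subset_union_left, ?_, ?_, ?_⟩
  · refine (Finset.card_union_le _ _).trans (Nat.add_le_add_left ?_ _)
    rw [mul_comm]
    refine Finset.card_biUnion_le_card_mul _ _ _ fun v _ => ?_
    exact (Finset.card_insert_le _ _).trans (Nat.add_le_add_right (hnbr v) 1)
  · have hvis : (free ×ˢ Finset.Icc 2 (T + 1)).card ≤ D ^ 3 * A'.card := by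
      refine hc.card_visits_le hD (a := a) (δ := δ) (L := L) (p := p) _ _ fun q hq => ?_
      have hq' := Finset.mem_product.1 hq
      obtain ⟨-, h1, h2, h3, h4, h5, -⟩ := hfree q.1 hq'.1
      refine ⟨h1, h2, h3, h4, ?_, Finset.mem_image_of_mem (fun q : V × ℕ => p q.1 q.2) hq⟩
      have := Finset.mem_Icc.1 hq'.2
      omega
    rw [Finset.card_product, Nat.card_Icc] at hvis
    have e : T + 1 + 1 - 2 = T := by omega
    rw [e] at hvis
    calc A.card * T ≤ (D * B.card + (D ^ 3 * B.card + free.card)) * T :=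
          Nat.mul_le_mul_right _ (by omega)
      _ = free.card * T + (D + D ^ 3) * B.card * T := by ring
      _ ≤ _ := Nat.add_le_add_right hvis _
  · intro z hz
    obtain ⟨q, hq, rfl⟩ := Finset.mem_image.1 hz
    have hq' := Finset.mem_product.1 hq
    have ht := Finset.mem_Icc.1 hq'.2
    obtain ⟨hxA, -, -, -, -, hL, hnext⟩ := hfree q.1 hq'.1
    have hB' : ∀ x ∈ A, ∀ u, u = p x 1 ∨ u = x ∨ G.Adj x u → u ∈ B' := by
      intro x hx u hu
      refine Finset.mem_union_right _ (Finset.mem_biUnion.2 ⟨x, hx, ?_⟩)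
      simpa using hu
    obtain ⟨t, ht'⟩ : ∃ t, q.2 = t + 1 := ⟨q.2 - 1, by omega⟩
    rw [ht']
    refine hnext t (by omega) (by omega) A' B' Finset.subset_union_left
      (fun x hx => hB' x hx x (Or.inr (Or.inl rfl))) (hB' _ hxA _ (Or.inr (Or.inl rfl)))
      (fun u hu => hB' _ hxA _ (Or.inr (Or.inr hu))) (hB' _ hxA _ (Or.inl rfl)) ?_
    intro s hs2 hsL
    exact Finset.mem_image.2 ⟨(q.1, s), Finset.mem_product.2 ⟨hq'.1, Finset.mem_Icc.2
      ⟨hs2, by omega⟩⟩, rfl⟩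

end Chain

theorem ProperOn.exists_missing [Fintype V] {G : SimpleGraph V} [DecidableRel G.Adj] {D : ℕ}
    {c : Sym2 V → Option ℕ} (hc : ProperOn G D c) (hD : ∀ v, G.degree v < D) (v : V) :
    ∃ k, 1 ≤ k ∧ k ≤ D ∧ Missing c v k := by
  classical
  by_contra! hcon
  have hex : ∀ k, ∃ w, k ∈ Finset.Icc 1 D → c s(v, w) = some k := fun k => by
    by_cases hk : k ∈ Finset.Icc 1 D
    · have := hcon k (Finset.mem_Icc.1 hk).1 (Finset.mem_Icc.1 hk).2
      simp only [Missing, not_forall, not_not] at this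
      exact this.imp fun w hw _ => hw
    · exact ⟨v, fun h => (hk h).elim⟩
  choose g hg using hex
  have hle : (Finset.Icc 1 D).card ≤ (G.neighborFinset v).card := by
    refine Finset.card_le_card_of_injOn g (fun k hk => ?_) fun k hk k' hk' e => ?_
    · simpa using (hc.1 _ _ _ (hg k hk)).1
    · have h := hg k hk
      rw [e, hg k' hk'] at h
      exact (Option.some.inj h).symm
  rw [Nat.card_Icc, card_neighborFinset_eq_degree] at hle
  have := hD v
  omega

theorem ChainState.initial {G : SimpleGraph V} {D : ℕ} {c : Sym2 V → Option ℕ} {m : V → ℕ}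
    (hc : ProperOn G D c) (hm : ∀ v, 1 ≤ m v) (S A : Finset V) {x y : V}
    (hxy : G.Adj x y) (h : c s(x, y) = none) :
    ChainState G D c m S S A 0 x y s(x, y) c 0 0 ∅ where
  mem_edgeSet := hxy
  uncoloured := h
  proper := hc
  adj := hxy
  uncoloured' := h
  eq_of_none f hf := (em (f = s(x, y))).imp_right fun hne => ⟨hf, hne⟩
  avoid _ _ _ := rfl
  ncard_le := by simp
  changed _ _ _ hne := (hne rfl).elim
  not_missing _ hu := hu.elim
  closed _ hu := hu.elim
  subset _ hu := hu.elim
  missing w hw := absurd (hc.1 _ _ _ hw).2.1 (by norm_num)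
  colours := Or.inl rfl
  ne_left := by have := hm x; omega
  ne_right := by have := hm x; omega

section Growth

variable [Fintype V] [DecidableEq V] {G : SimpleGraph V} [DecidableRel G.Adj] {D : ℕ}
  {c : Sym2 V → Option ℕ} {m : V → ℕ}

/-- If few vertices are forbidden, then the sets of reachable vertices at least double in every
round until an augmentation is found. -/
theorem augmentation_or_large (hc : ProperOn G D c) (hD : ∀ v, G.degree v < D) (hD2 : 2 ≤ D)
    (hm : ∀ v, 1 ≤ m v ∧ m v ≤ D ∧ Missing c v (m v)) {S A₀ : Finset V} (hne : A₀.Nonempty)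
    (hA₀ : ∀ x ∈ A₀, ∃ y, G.Adj x y ∧ c s(x, y) = none) (hS : 4 * D ^ 3 * S.card ≤ A₀.card)
    (i : ℕ) :
    ShortAugmentation G D c S (i * (16 * D ^ 7 + D + 3)) ∨
      ∃ A B, S ⊆ B ∧ 4 * D ^ 3 * B.card ≤ A.card ∧ 2 ^ i ≤ A.card ∧
        ∀ x ∈ A, ∃ y e c' κ₁ κ₂ P,
          ChainState G D c m S B A (i * (16 * D ^ 7 + D + 3)) x y e c' κ₁ κ₂ P := by
  induction i with
  | zero =>
    refine Or.inr ⟨A₀, S, subset_rfl, hS, by simpa using hne.card_pos, fun x hx => ?_⟩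
    obtain ⟨y, hxy, h⟩ := hA₀ x hx
    rw [zero_mul]
    exact ⟨y, _, _, _, _, _, ChainState.initial hc (fun v => (hm v).1) S A₀ hxy h⟩
  | succ i ih =>
    have hN : i * (16 * D ^ 7 + D + 3) + D + (16 * D ^ 7 + 3) =
        (i + 1) * (16 * D ^ 7 + D + 3) := by ring
    obtain h | ⟨A, B, hSB, hB, hA, hst⟩ := ih
    · exact Or.inl (h.mono (by rw [← hN]; omega))
    · obtain h | ⟨A', B', hSB', hB', hA', hst'⟩ :=
        exists_next_level hc hD hm hSB hst (16 * D ^ 7)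
      · exact Or.inl (hN ▸ h)
      · rw [hN] at hst'
        have hDp : 0 < D ^ 3 := by positivity
        have hD1 : D ≤ D ^ 3 := Nat.le_self_pow (by norm_num) D
        have hgrow : 8 * D ^ 4 * A.card ≤ A'.card := by
          have h1 : (D + D ^ 3) * B.card * (16 * D ^ 7) ≤ 8 * D ^ 7 * A.card := by
            calc (D + D ^ 3) * B.card * (16 * D ^ 7)
                ≤ (D ^ 3 + D ^ 3) * B.card * (16 * D ^ 7) := by gcongr
              _ = 8 * D ^ 7 * (4 * D ^ 3 * B.card) := by ring
              _ ≤ _ := by gcongr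
          have h2 : D ^ 3 * (8 * D ^ 4 * A.card) ≤ D ^ 3 * A'.card := by
            have e1 : D ^ 3 * (8 * D ^ 4 * A.card) = 8 * D ^ 7 * A.card := by ring
            have e2 : A.card * (16 * D ^ 7) = 8 * D ^ 7 * A.card + 8 * D ^ 7 * A.card := by ring
            omega
          exact Nat.le_of_mul_le_mul_left h2 hDp
        refine Or.inr ⟨A', B', hSB', ?_, ?_, hst'⟩
        · have h4 : 2 * D ^ 3 ≤ D ^ 4 := by rw [pow_succ' D 3]; gcongr
          calc 4 * D ^ 3 * B'.card
              ≤ 4 * D ^ 3 * (B.card + (D + 1) * A.card) := by gcongr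
            _ = 4 * D ^ 3 * B.card + (4 * D ^ 4 + 4 * D ^ 3) * A.card := by ring
            _ ≤ A.card + (4 * D ^ 4 + 4 * D ^ 3) * A.card := by gcongr
            _ = (4 * D ^ 4 + 4 * D ^ 3 + 1) * A.card := by ring
            _ ≤ 8 * D ^ 4 * A.card := Nat.mul_le_mul_right _ (by omega)
            _ ≤ _ := hgrow
        · have h4 : 1 ≤ D ^ 4 := Nat.one_le_pow _ _ (by omega)
          rw [pow_succ]
          nlinarith

theorem exists_shortAugmentation (hc : ProperOn G D c) (hD : ∀ v, G.degree v < D) {S : Finset V}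
    (hU : (G.edgeFinset.filter fun e => c e = none).Nonempty)
    (hS : 4 * D ^ 4 * S.card ≤ (G.edgeFinset.filter fun e => c e = none).card) :
    ShortAugmentation G D c S ((Nat.log 2 (Fintype.card V) + 1) * (16 * D ^ 7 + D + 3)) := by
  choose m hm using hc.exists_missing hD
  let A₀ : Finset V := Finset.univ.filter fun x => ∃ y, G.Adj x y ∧ c s(x, y) = none
  have hA₀ : ∀ x, x ∈ A₀ ↔ ∃ y, G.Adj x y ∧ c s(x, y) = none := by simp [A₀]
  have hUA : (G.edgeFinset.filter fun e => c e = none).card ≤ D * A₀.card := by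
    have hsub : (G.edgeFinset.filter fun e => c e = none) ⊆
        A₀.biUnion fun x => (G.neighborFinset x).image fun y => s(x, y) := by
      intro e he
      induction e with | _ x y
      simp only [Finset.mem_filter, mem_edgeFinset, mem_edgeSet] at he
      exact Finset.mem_biUnion.2 ⟨x, (hA₀ x).2 ⟨y, he⟩,
        Finset.mem_image.2 ⟨y, by simpa using he.1, rfl⟩⟩
    rw [mul_comm]
    refine (Finset.card_le_card hsub).trans (Finset.card_biUnion_le_card_mul _ _ _ fun x _ => ?_)
    exact Finset.card_image_le.trans (by rw [card_neighborFinset_eq_degree]; exact (hD x).le)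
  have hpos : 0 < D * A₀.card := hU.card_pos.trans_le hUA
  have hDpos : 0 < D := Nat.pos_of_mul_pos_right hpos
  have hS' : 4 * D ^ 3 * S.card ≤ A₀.card := by
    refine Nat.le_of_mul_le_mul_left (c := D) ?_ hDpos
    calc D * (4 * D ^ 3 * S.card) = 4 * D ^ 4 * S.card := by ring
      _ ≤ _ := hS.trans hUA
  have hne : A₀.Nonempty := Finset.card_pos.1 (Nat.pos_of_mul_pos_left hpos)
  have hD2 : 2 ≤ D := by
    obtain ⟨x, hx⟩ := hne
    obtain ⟨y, hxy, -⟩ := (hA₀ x).1 hx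
    have h1 : 0 < G.degree x := (G.degree_pos_iff_exists_adj x).2 ⟨y, hxy⟩
    have h2 := hD x
    omega
  refine (augmentation_or_large hc hD hD2 hm hne (fun x hx => (hA₀ x).1 hx) hS'
    _).resolve_right ?_
  rintro ⟨A, B, -, -, hA, -⟩
  exact absurd (hA.trans A.card_le_univ) (not_le.2 (Nat.lt_pow_succ_log_self one_lt_two _))

end Growth

section Changed

variable {G : SimpleGraph V} {c : Sym2 V → Option ℕ}

/-- The subgraph formed by the edges on which two proper colourings differ. -/
def changedSubgraph {D : ℕ} {c' : Sym2 V → Option ℕ} (hc : ProperOn G D c)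
    (hc' : ProperOn G D c') : G.Subgraph where
  verts := {v | ∃ w, c' s(v, w) ≠ c s(v, w)}
  Adj v w := c' s(v, w) ≠ c s(v, w)
  adj_sub {v w} h := by
    rcases h1 : c' s(v, w) with _ | k
    · rcases h2 : c s(v, w) with _ | k
      · exact (h (h1.trans h2.symm)).elim
      · exact (hc.1 _ _ _ h2).1
    · exact (hc'.1 _ _ _ h1).1
  edge_vert h := ⟨_, h⟩
  symm := ⟨fun v w h => by rwa [Sym2.eq_swap]⟩

theorem edgeSet_changedSubgraph {D : ℕ} {c' : Sym2 V → Option ℕ} (hc : ProperOn G D c)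
    (hc' : ProperOn G D c') : (changedSubgraph hc hc').edgeSet = {f | c' f ≠ c f} := by
  ext f
  induction f with | _ x y
  rfl

theorem ncard_verts_changedSubgraph_le [Fintype V] {D : ℕ} {c' : Sym2 V → Option ℕ} (hc : ProperOn G D c)
    (hc' : ProperOn G D c') :
    (changedSubgraph hc hc').verts.ncard ≤ 2 * {f | c' f ≠ c f}.ncard := by
  classical
  let E : Finset (Sym2 V) := Finset.univ.filter fun f => c' f ≠ c f
  have hE : {f | c' f ≠ c f} = (E : Set (Sym2 V)) := by ext; simp [E]
  have hsub : (changedSubgraph hc hc').verts ⊆ (E.biUnion Sym2.toFinset : Finset V) := by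
    rintro v ⟨w, h⟩
    simp only [Finset.mem_coe, Finset.mem_biUnion]
    exact ⟨s(v, w), by simpa [E] using h, by simp⟩
  rw [hE, Set.ncard_coe_finset, mul_comm]
  refine (Set.ncard_le_ncard hsub (Finset.finite_toSet _)).trans ?_
  rw [Set.ncard_coe_finset]
  refine Finset.card_biUnion_le_card_mul _ _ _ fun f _ => ?_
  rw [Sym2.card_toFinset]
  split_ifs <;> omega

end Changed

section Greedy

variable [Fintype V] {G : SimpleGraph V} [DecidableRel G.Adj] {c : Sym2 V → Option ℕ}

theorem IsProperPartialVizing.properOn (hc : IsProperPartialVizing G c) :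
    ProperOn G (G.maxDegree + 1) c := by
  refine ⟨fun v w k h => ⟨(hc.1.1 _ _ h).1, (hc.1.1 _ _ h).2, hc.2 _ _ h⟩, ?_⟩
  intro v w w' k h h'
  by_contra hne
  refine hc.1.2 s(v, w) s(v, w') k (fun e => hne ?_) ⟨v, by simp, by simp⟩ h h'
  exact Sym2.congr_right.1 e

theorem ProperOn.isProperPartialVizing (hc : ProperOn G (G.maxDegree + 1) c) :
    IsProperPartialVizing G c := by
  refine ⟨⟨fun e k h => ?_, ?_⟩, fun e k h => ?_⟩
  · induction e with | _ x y
    exact ⟨(hc.1 _ _ _ h).1, (hc.1 _ _ _ h).2.1⟩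
  · rintro e₁ e₂ k hne ⟨z, ⟨x, rfl⟩, ⟨y, rfl⟩⟩ h₁ h₂
    exact hne (by rw [hc.2 _ _ _ _ h₁ h₂])
  · induction e with | _ x y
    exact (hc.1 _ _ _ h).2.2

/-- Pairwise vertex-disjoint augmenting subgraphs with at most `h` edges for the edges of `W`. -/
def IsAugmentingFamily (G : SimpleGraph V) [DecidableRel G.Adj] (c : Sym2 V → Option ℕ) (h : ℕ)
    (W : Finset (Sym2 V)) (H : Sym2 V → G.Subgraph) : Prop :=
  (∀ e ∈ W, e ∈ G.edgeSet ∧ c e = none ∧ IsAugmentingSubgraph G c e (H e) ∧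
    (H e).edgeSet.ncard ≤ h ∧ (H e).verts.ncard ≤ 2 * h) ∧
  ∀ e ∈ W, ∀ f ∈ W, e ≠ f → Disjoint (H e).verts (H f).verts

theorem IsAugmentingFamily.extend [DecidableEq V] {h : ℕ} {W : Finset (Sym2 V)}
    {H : Sym2 V → G.Subgraph} (hW : IsAugmentingFamily G c h W H) {S : Finset V}
    (hS : ∀ e ∈ W, (H e).verts ⊆ S) (hc : ProperOn G (G.maxDegree + 1) c)
    (haug : ShortAugmentation G (G.maxDegree + 1) c S h) :
    ∃ e H', e ∉ W ∧ IsAugmentingFamily G c h (insert e W) H' := by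
  obtain ⟨e, c', heG, hce, hc', hnone, hav, hcard⟩ := haug
  have hce' : c' e ≠ none := fun h0 => (hnone e h0).2 rfl
  have hee : e ∈ (changedSubgraph hc hc').edgeSet := by
    rw [edgeSet_changedSubgraph, Set.mem_ofPred_eq, hce]
    exact hce'
  have hdisj : ∀ f ∈ W, Disjoint (changedSubgraph hc hc').verts (H f).verts := by
    intro f hf
    refine Set.disjoint_left.2 ?_
    rintro v ⟨w, hvw⟩ hv
    exact hvw (hav v (hS f hf hv) w)
  have heW : e ∉ W := by
    intro heW
    induction e with | _ x y
    exact Set.disjoint_left.1 (hdisj _ heW) (Subgraph.edge_vert _ hee)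
      (Subgraph.edge_vert _ (hW.1 _ heW).2.2.1.1)
  have hne : ∀ f ∈ W, f ≠ e := fun f hf h0 => heW (h0 ▸ hf)
  refine ⟨e, Function.update H e (changedSubgraph hc hc'), heW, ?_, ?_⟩
  · intro f hf
    rcases Finset.mem_insert.1 hf with rfl | hf
    · rw [Function.update_self]
      refine ⟨heG, hce, ⟨hee, c', hc'.isProperPartialVizing, hce', ?_, ?_⟩, ?_, ?_⟩
      · exact fun f hf h0 => hf (hnone f h0).1
      · intro f hf
        rw [edgeSet_changedSubgraph, Set.mem_ofPred_eq, not_not] at hf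
        exact hf
      · rwa [edgeSet_changedSubgraph]
      · exact (ncard_verts_changedSubgraph_le hc hc').trans (by omega)
    · rw [Function.update_of_ne (hne f hf)]
      exact hW.1 f hf
  · intro f hf g hg hfg
    rcases Finset.mem_insert.1 hf with rfl | hf' <;> rcases Finset.mem_insert.1 hg with rfl | hg'
    · exact (hfg rfl).elim
    · rw [Function.update_self, Function.update_of_ne (hne g hg')]
      exact hdisj g hg'
    · rw [Function.update_self, Function.update_of_ne (hne f hf')]
      exact (hdisj f hf').symm
    · rw [Function.update_of_ne (hne f hf'), Function.update_of_ne (hne g hg')]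
      exact hW.2 f hf' g hg' hfg

theorem exists_isAugmentingFamily [DecidableEq V] (hc : ProperOn G (G.maxDegree + 1) c) {h : ℕ}
    (hh : h = (Nat.log 2 (Fintype.card V) + 1) *
      (16 * (G.maxDegree + 1) ^ 7 + (G.maxDegree + 1) + 3)) :
    ∃ W H, IsAugmentingFamily G c h W H ∧
      (G.edgeFinset.filter fun e => c e = none).card ≤
        4 * (G.maxDegree + 1) ^ 4 * (2 * h * W.card) := by
  classical
  have hex : ∃ W : Finset (Sym2 V), (∃ H, IsAugmentingFamily G c h W H) ∧
      ∀ W', (∃ H, IsAugmentingFamily G c h W' H) → W'.card ≤ W.card := by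
    obtain ⟨W, hW, hmax⟩ := Finset.exists_max_image
      (Finset.univ.filter fun W : Finset (Sym2 V) => ∃ H, IsAugmentingFamily G c h W H)
      Finset.card ⟨∅, by simp [IsAugmentingFamily]⟩
    exact ⟨W, (Finset.mem_filter.1 hW).2, fun W' hW' =>
      hmax W' (Finset.mem_filter.2 ⟨Finset.mem_univ _, hW'⟩)⟩
  obtain ⟨W, ⟨H, hWH⟩, hmax⟩ := hex
  refine ⟨W, H, hWH, ?_⟩
  by_contra! hlt
  let S : Finset V := W.biUnion fun e => (H e).verts.toFinset
  have hScard : S.card ≤ 2 * h * W.card := by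
    rw [mul_comm]
    refine Finset.card_biUnion_le_card_mul _ _ _ fun e he => ?_
    rw [← Set.ncard_eq_toFinset_card']
    exact (hWH.1 e he).2.2.2.2
  have haug : ShortAugmentation G (G.maxDegree + 1) c S h := by
    rw [hh]
    refine exists_shortAugmentation hc (fun v => Nat.lt_succ_of_le (G.degree_le_maxDegree v))
      (Finset.card_pos.1 (Nat.zero_lt_of_lt hlt)) ?_
    exact (Nat.mul_le_mul_left _ hScard).trans hlt.le
  obtain ⟨e, H', he, hW'⟩ := hWH.extend (S := S)
    (fun e he v hv => Finset.mem_coe.2 (Finset.mem_biUnion.2 ⟨e, he, Set.mem_toFinset.2 hv⟩))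
    hc haug
  have := hmax _ ⟨H', hW'⟩
  rw [Finset.card_insert_of_notMem he] at this
  omega

end Greedy

theorem natLog_two_add_one_le {n : ℕ} (hn : 2 ≤ n) :
    ((Nat.log 2 n + 1 : ℕ) : ℝ) ≤ 3 * Real.log n := by
  have h2 : (Nat.log 2 n : ℝ) * Real.log 2 ≤ Real.log n := by
    rw [← Real.log_pow]
    refine Real.log_le_log (by positivity) ?_
    exact_mod_cast Nat.pow_log_le_self 2 (by omega)
  have h1 : (1 : ℝ) ≤ Nat.log 2 n := by exact_mod_cast Nat.log_pos one_lt_two hn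
  have := Real.log_two_gt_d9
  push_cast
  nlinarith

/-- **Many vertex-disjoint small augmenting subgraphs.** There is an absolute constant
`C` such that for any finite simple graph on `n ≥ 2` vertices of maximum degree `Δ ≥ 1`
with a proper partial `(Δ+1)`-edge colouring `c` whose set of uncoloured edges is `U`,
there exist `W ⊆ U` with `|W| ≥ |U| / (C (Δ+1)^12 log n)` and pairwise vertex-disjoint
augmenting subgraphs `H e` for the edges `e ∈ W`, each with at most
`C (Δ+1)^8 log n` edges. -/
theorem many_disjoint_augmenting_subgraphs :
    ∃ C : ℝ, 0 < C ∧
      ∀ (V : Type) [Fintype V] [DecidableEq V] (G : SimpleGraph V) [DecidableRel G.Adj],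
        2 ≤ Fintype.card V → 1 ≤ G.maxDegree →
        ∀ c : Sym2 V → Option ℕ, IsProperPartialVizing G c →
          ∃ (W : Finset (Sym2 V)) (H : Sym2 V → G.Subgraph),
            W ⊆ G.edgeFinset.filter (fun e => c e = none) ∧
            ((G.edgeFinset.filter (fun e => c e = none)).card : ℝ) /
                (C * ((G.maxDegree : ℝ) + 1) ^ 12 * Real.log (Fintype.card V)) ≤
              (W.card : ℝ) ∧
            (∀ e ∈ W, IsAugmentingSubgraph G c e (H e) ∧
              ((H e).edgeSet.ncard : ℝ) ≤
                C * ((G.maxDegree : ℝ) + 1) ^ 8 * Real.log (Fintype.card V)) ∧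
            ∀ e ∈ W, ∀ f ∈ W, e ≠ f → Disjoint (H e).verts (H f).verts := by
  refine ⟨500, by norm_num, fun V _ _ G _ hn hΔ c hc => ?_⟩
  obtain ⟨W, H, hW, hcard⟩ := exists_isAugmentingFamily hc.properOn rfl
  have hlog : 0 < Real.log (Fintype.card V) := Real.log_pos (by exact_mod_cast hn)
  have hD : (2 : ℝ) ≤ (G.maxDegree : ℝ) + 1 := by
    have : (1 : ℝ) ≤ G.maxDegree := by exact_mod_cast hΔ
    linarith
  set h := (Nat.log 2 (Fintype.card V) + 1) *
    (16 * (G.maxDegree + 1) ^ 7 + (G.maxDegree + 1) + 3) with hh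
  have hcard' : ((G.edgeFinset.filter (fun e => c e = none)).card : ℝ) ≤
      4 * ((G.maxDegree : ℝ) + 1) ^ 4 * (2 * h * W.card) := by exact_mod_cast hcard
  have hh' : (h : ℝ) ≤ 3 * Real.log (Fintype.card V) *
      (16 * ((G.maxDegree : ℝ) + 1) ^ 7 + ((G.maxDegree : ℝ) + 1) + 3) := by
    rw [hh, Nat.cast_mul]
    push_cast
    have := natLog_two_add_one_le hn
    push_cast at this
    gcongr
  clear_value h
  generalize (G.maxDegree : ℝ) + 1 = D at *
  have hh7 : (h : ℝ) ≤ 51 * D ^ 7 * Real.log (Fintype.card V) := by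
    have h7 : D + 3 ≤ D ^ 7 := by
      have : (2 : ℝ) ^ 6 ≤ D ^ 6 := by gcongr
      nlinarith
    nlinarith
  refine ⟨W, H, fun e he => ?_, ?_, fun e he => ⟨(hW.1 e he).2.2.1, ?_⟩, hW.2⟩
  · simpa using ⟨(hW.1 e he).1, (hW.1 e he).2.1⟩
  · rw [div_le_iff₀ (by positivity)]
    refine hcard'.trans ?_
    calc 4 * D ^ 4 * (2 * h * W.card)
        ≤ 4 * D ^ 4 * (2 * (51 * D ^ 7 * Real.log (Fintype.card V)) * W.card) := by gcongr
      _ = W.card * (408 * D ^ 11 * Real.log (Fintype.card V)) := by ring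
      _ ≤ W.card * (500 * D ^ 12 * Real.log (Fintype.card V)) := by
        gcongr
        · norm_num
        · linarith
        · norm_num
  · calc ((H e).edgeSet.ncard : ℝ) ≤ h := by exact_mod_cast (hW.1 e he).2.2.2.1
      _ ≤ 51 * D ^ 7 * Real.log (Fintype.card V) := hh7
      _ ≤ 500 * D ^ 8 * Real.log (Fintype.card V) := by
        gcongr
        · norm_num
        · linarith
        · norm_num
end

section
/- Let c₁ be a strictly local proper partial (Δ+1)-edge colouring of a finite simple graph G, and let c₂ be obtained from c₁ by i-shifting a strictly local fan (uw₁,…,uw_k), for some 1 ≤ i ≤ k. Then Φ(G,c₂) ≤ Φ(G,c₁). -/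
open SimpleGraph

variable {V : Type*}

/-- A colour `κ` is available at a vertex `v` if no edge incident to `v` is coloured `κ`. -/
def Available (G : SimpleGraph V) (c : Sym2 V → Option ℕ) (v : V) (κ : ℕ) : Prop :=
  ∀ x, G.Adj v x → c s(v, x) ≠ some κ

/-- A partial edge colouring is strictly local if every coloured edge `uv` receives a
colour in `{1, …, max (d u) (d v) + 1}`. -/
def StrictlyLocal (G : SimpleGraph V) [Fintype V] [DecidableRel G.Adj]
    (c : Sym2 V → Option ℕ) : Prop :=
  ∀ u v κ, G.Adj u v → c s(u, v) = some κ → κ ≤ max (G.degree u) (G.degree v) + 1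

/-- `(u w 0, …, u w (k-1))` is a fan with center `u`. -/
def IsFan (G : SimpleGraph V) (c : Sym2 V → Option ℕ) (u : V) (w : ℕ → V) (k : ℕ) :
    Prop :=
  Set.InjOn w (Set.Iio k) ∧ (∀ i < k, G.Adj u (w i)) ∧ c s(u, w 0) = none ∧
  ∀ i, i + 1 < k → ∃ β, c s(u, w (i + 1)) = some β ∧ Available G c (w i) β

/-- The potential `Φ(G, c) = ∑_{κ = 1}^{Δ+1} |{v : κ ∈ A(v) ∧ κ ≤ d(v) + 1}|`. -/
noncomputable def potential (G : SimpleGraph V) [Fintype V] [DecidableRel G.Adj]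
    (c : Sym2 V → Option ℕ) : ℕ :=
  ∑ κ ∈ Finset.Icc 1 (G.maxDegree + 1),
    {v : V | Available G c v κ ∧ κ ≤ G.degree v + 1}.ncard

/-- **Shifting a strictly local fan never increases the potential.** Here `c₂` is obtained
from the strictly local proper partial `(Δ+1)`-edge colouring `c₁` by `i`-shifting the
strictly local fan `(u w 0, …, u w (k-1))`. -/
theorem potential_fan_shift (V : Type*) [Fintype V] [DecidableEq V]
    (G : SimpleGraph V) [DecidableRel G.Adj]
    (c₁ c₂ : Sym2 V → Option ℕ)
    (hc₁ : IsProperPartialVizing G c₁) (hsl : StrictlyLocal G c₁)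
    (u : V) (w : ℕ → V) (k : ℕ) (hfan : IsFan G c₁ u w k)
    (hslfan : ∀ i β, i + 1 < k → c₁ s(u, w (i + 1)) = some β →
      β ≤ G.degree (w i) + 1)
    (i : ℕ) (hi1 : 1 ≤ i) (hik : i ≤ k)
    (hshift₁ : ∀ j, j + 1 < i → c₂ s(u, w j) = c₁ s(u, w (j + 1)))
    (hshift₂ : c₂ s(u, w (i - 1)) = none)
    (hshift₃ : ∀ f, (∀ j < i, f ≠ s(u, w j)) → c₂ f = c₁ f) :
    potential G c₂ ≤ potential G c₁ := by
  obtain ⟨-, hadj, hnone, hav⟩ := hfan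
  obtain ⟨⟨-, hproper⟩, -⟩ := hc₁
  have gain : ∀ κ v, Available G c₂ v κ → ¬ Available G c₁ v κ →
      ∃ j, j + 1 < i ∧ c₁ s(u, w (j + 1)) = some κ ∧ v = w (j + 1) := by
    intro κ v h₂ h₁
    simp only [Available, not_forall, not_not] at h₁
    obtain ⟨x, hvx, hx⟩ := h₁
    have hex : ∃ j < i, s(v, x) = s(u, w j) := by
      by_contra! hne
      exact h₂ x hvx ((hshift₃ _ hne).trans hx)
    obtain ⟨j, hj, he⟩ := hex
    rw [he] at hx
    rcases j with _ | j
    · simp [hnone] at hx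
    · refine ⟨j, hj, hx, ?_⟩
      rcases Sym2.eq_iff.mp he with ⟨rfl, -⟩ | ⟨hv, -⟩
      · exact absurd ((hshift₁ j hj).trans hx) (h₂ _ (hadj j (by omega)))
      · exact hv
  refine Finset.sum_le_sum fun κ _ => ?_
  by_cases hκ : ∃ j, j + 1 < i ∧ c₁ s(u, w (j + 1)) = some κ
  · obtain ⟨j, hj, hc⟩ := hκ
    obtain ⟨β, hβ, hβa⟩ := hav j (by omega)
    obtain rfl : κ = β := Option.some.inj (hc.symm.trans hβ)
    have hmem : w j ∈ {v : V | Available G c₁ v κ ∧ κ ≤ G.degree v + 1} :=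
      ⟨hβa, hslfan j κ (by omega) hc⟩
    have hsub : {v : V | Available G c₂ v κ ∧ κ ≤ G.degree v + 1} ⊆
        insert (w (j + 1)) ({v : V | Available G c₁ v κ ∧ κ ≤ G.degree v + 1} \ {w j}) := by
      rintro v ⟨hv, hd⟩
      by_cases h₁ : Available G c₁ v κ
      · refine Or.inr ⟨⟨h₁, hd⟩, ?_⟩
        rintro rfl
        refine hv u (hadj j (by omega)).symm ?_
        rw [Sym2.eq_swap, hshift₁ j hj, hc]
      · obtain ⟨l, -, hlc, rfl⟩ := gain κ v hv h₁
        left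
        by_contra hne
        refine hproper s(u, w (l + 1)) s(u, w (j + 1)) κ ?_ ⟨u, by simp, by simp⟩ hlc hc
        exact fun h => hne (Sym2.congr_right.mp h)
    calc _ ≤ _ := Set.ncard_le_ncard hsub (Set.toFinite _)
      _ ≤ _ := Set.ncard_insert_le _ _
      _ = _ := Set.ncard_sdiff_singleton_add_one hmem (Set.toFinite _)
  · refine Set.ncard_le_ncard ?_ (Set.toFinite _)
    rintro v ⟨hv, hd⟩
    refine ⟨?_, hd⟩
    by_contra h₁
    obtain ⟨j, hj, hc, -⟩ := gain κ v hv h₁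
    exact hκ ⟨j, hj, hc⟩
end

section
/- Let c be a strictly local proper partial (Δ+1)-edge colouring of a finite simple graph G and let F = (uw₁,…,uw_k) be a strictly local fan on an uncoloured edge uv (so w₁ = v). Suppose κ₂ ∈ A(w_k) ∩ {1,…,d(w_k)+1} satisfies κ₂ ∉ A(u) and κ₂ = c(uw_{i+1}) for some i < k (the representative available colour of w_i), and let κ₁ ∈ A(u) ∩ {1,…,d(u)+1}. Let P' be the (κ₁,κ₂)-bichromatic path having w_k as an endpoint, and suppose that, traversing P' from w_k, there is an edge whose colour after shifting P' would exceed max of the degrees of its endpoints plus 1; let xy be the first such edge and let P be the portion of P' from w_k up to and including xy. Then neither endpoint of the last edge xy of P is equal to u, to w_k, or to w_i. -/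
open SimpleGraph

variable {V : Type*}

/-- `x 0, x 1, …, x m` are the vertices of the `(κ₁,κ₂)`-bichromatic path rooted at
`x 0`, traversed starting from `x 0`: the vertices are distinct, consecutive vertices are
adjacent, the edge colours alternate `κ₁, κ₂, κ₁, …`, and the path is maximal (the colour
that would continue the alternation is available at the final vertex `x m`). -/
def IsBichromPathFrom (G : SimpleGraph V) (c : Sym2 V → Option ℕ) (κ₁ κ₂ : ℕ)
    (x : ℕ → V) (m : ℕ) : Prop :=
  Set.InjOn x (Set.Iic m) ∧
  (∀ j < m, G.Adj (x j) (x (j + 1))) ∧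
  (∀ j < m, c s(x j, x (j + 1)) = some (if Even j then κ₁ else κ₂)) ∧
  Available G c (x m) (if Even m then κ₁ else κ₂)

/-- **The truncation edge of a strictly local Vizing chain avoids `u`, `w_k` and `w_i`.**
Given a strictly local fan `(u w 0, …, u w (k-1))` on the uncoloured edge `u v`, with
`κ₂` the representative available colour of both `w i` and the last vertex `w (k-1)`,
`κ₂ ∉ A(u)`, `κ₁ ∈ A(u) ∩ [d(u)+1]`, and given the `(κ₁,κ₂)`-bichromatic path starting at
`w (k-1)`, if `t` indexes the first edge of the path that would violate strict locality
after shifting the path, then neither endpoint of that edge is `u`, `w (k-1)` or `w i`. -/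
theorem truncation_edge_avoids_fan (V : Type*) [Fintype V] [DecidableEq V]
    (G : SimpleGraph V) [DecidableRel G.Adj]
    (c : Sym2 V → Option ℕ) (hc : IsProperPartialVizing G c) (hsl : StrictlyLocal G c)
    (u v : V) (huv : G.Adj u v) (hun : c s(u, v) = none)
    (w : ℕ → V) (k : ℕ) (hfan : IsFan G c u w k) (hw0 : w 0 = v)
    (hslfan : ∀ i β, i + 1 < k → c s(u, w (i + 1)) = some β → β ≤ G.degree (w i) + 1)
    (i : ℕ) (hik : i + 1 < k) (κ₁ κ₂ : ℕ)
    (hκ₂rep : c s(u, w (i + 1)) = some κ₂)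
    (hκ₂wk : Available G c (w (k - 1)) κ₂) (hκ₂d : κ₂ ≤ G.degree (w (k - 1)) + 1)
    (hκ₂u : ¬ Available G c u κ₂)
    (hκ₁u : Available G c u κ₁) (hκ₁d : κ₁ ≤ G.degree u + 1)
    (x : ℕ → V) (m : ℕ) (hx0 : x 0 = w (k - 1))
    (hpath : IsBichromPathFrom G c κ₁ κ₂ x m)
    (t : ℕ) (htm : t < m)
    (hviol : max (G.degree (x t)) (G.degree (x (t + 1))) + 1 <
      (if Even t then κ₂ else κ₁))
    (hfirst : ∀ j < t, ¬ (max (G.degree (x j)) (G.degree (x (j + 1))) + 1 <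
      (if Even j then κ₂ else κ₁))) :
    x t ≠ u ∧ x (t + 1) ≠ u ∧ x t ≠ w (k - 1) ∧ x (t + 1) ≠ w (k - 1) ∧
      x t ≠ w i ∧ x (t + 1) ≠ w i := by
  have hadj := hpath.2.1 t htm
  have hcol := hpath.2.2.1 t htm
  have not_endpoint : ∀ z κ, c s(x t, x (t + 1)) = some κ → Available G c z κ →
      x t ≠ z ∧ x (t + 1) ≠ z := by
    intro z κ hκ hz
    constructor
    · rintro rfl
      exact hz _ hadj hκ
    · rintro rfl
      exact hz _ hadj.symm (by rwa [Sym2.eq_swap])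
  have not_endpoint_of_le : ∀ z κ,
      max (G.degree (x t)) (G.degree (x (t + 1))) + 1 < κ → κ ≤ G.degree z + 1 →
      x t ≠ z ∧ x (t + 1) ≠ z := by
    intro z κ hκ hz
    constructor <;> rintro rfl <;> omega
  have hκ₂wi : Available G c (w i) κ₂ := by
    obtain ⟨β, hβ, hav⟩ := hfan.2.2.2 i hik
    rw [hκ₂rep, Option.some_inj] at hβ
    rwa [hβ]
  by_cases ht : Even t
  · rw [if_pos ht] at hcol hviol
    have hu := not_endpoint u κ₁ hcol hκ₁u
    have hk := not_endpoint_of_le _ κ₂ hviol hκ₂d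
    have hi := not_endpoint_of_le _ κ₂ hviol (hslfan i κ₂ hik hκ₂rep)
    exact ⟨hu.1, hu.2, hk.1, hk.2, hi.1, hi.2⟩
  · rw [if_neg ht] at hcol hviol
    have hu := not_endpoint_of_le u κ₁ hviol hκ₁d
    have hk := not_endpoint _ κ₂ hcol hκ₂wk
    have hi := not_endpoint _ κ₂ hcol hκ₂wi
    exact ⟨hu.1, hu.2, hk.1, hk.2, hi.1, hi.2⟩
end

section
/- Let c₁ be a strictly local proper partial (Δ+1)-edge colouring of a finite simple graph G and let F = (uw₁,…,uw_k) be a strictly local fan on an uncoloured edge uv (so w₁ = v). Suppose κ₂ ∈ A(w_k) ∩ {1,…,d(w_k)+1} satisfies κ₂ ∉ A(u) and κ₂ = c(uw_{i+1}) for some i < k, and let κ₁ ∈ A(u) ∩ {1,…,d(u)+1}. Let P' be the (κ₁,κ₂)-bichromatic path having w_k as an endpoint; suppose that, traversing P' from w_k, there is an edge whose colour after shifting P' would exceed the maximum of the degrees of its endpoints plus 1, let p₁,…,p_t be the edges of P' from w_k up to and including the first such edge, and let c₂ be the proper partial colouring obtained from c₁ by shifting the chain (uw₁,…,uw_k, p₁,…,p_t)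 (so that uv becomes coloured and the truncation edge p_t becomes uncoloured). Then Φ(G,c₂) ≤ Φ(G,c₁) − 1. -/
open SimpleGraph

variable {V : Type*}

open Classical in
/-- The colours `κ ∈ {1, …, d v + 1}` that are available at `v`. -/
noncomputable def localAvailable (G : SimpleGraph V) [Fintype V] [DecidableRel G.Adj]
    (c : Sym2 V → Option ℕ) (v : V) : Finset ℕ :=
  {κ ∈ Finset.Icc 1 (G.degree v + 1) | Available G c v κ}

theorem mem_localAvailable {G : SimpleGraph V} [Fintype V] [DecidableRel G.Adj]
    {c : Sym2 V → Option ℕ} {v : V} {κ : ℕ} :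
    κ ∈ localAvailable G c v ↔ (1 ≤ κ ∧ κ ≤ G.degree v + 1) ∧ Available G c v κ := by
  simp [localAvailable]

theorem potential_eq_sum_card_localAvailable (G : SimpleGraph V) [Fintype V]
    [DecidableRel G.Adj] (c : Sym2 V → Option ℕ) :
    potential G c = ∑ v, (localAvailable G c v).card := by
  classical
  have h : ∀ v, localAvailable G c v =
      {κ ∈ Finset.Icc 1 (G.maxDegree + 1) | Available G c v κ ∧ κ ≤ G.degree v + 1} := by
    intro v
    ext κ
    have := G.degree_le_maxDegree v
    simp only [mem_localAvailable, Finset.mem_filter, Finset.mem_Icc]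
    constructor
    · rintro ⟨⟨h₁, h₂⟩, h₃⟩
      exact ⟨⟨h₁, by omega⟩, h₃, h₂⟩
    · rintro ⟨⟨h₁, _⟩, h₃, h₂⟩
      exact ⟨⟨h₁, h₂⟩, h₃⟩
  simp only [potential, Set.ncard_eq_toFinset_card', Set.toFinset_ofPred, h,
    Finset.card_filter]
  exact Finset.sum_comm

/-- If the newly available local colours are, at each vertex, outweighed by the lost ones
up to a surplus of one at `z` and a deficit of one at each of `u ≠ v`, then the potential
drops. -/
theorem potential_add_one_le (G : SimpleGraph V) [Fintype V] [DecidableEq V]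
    [DecidableRel G.Adj] (c₁ c₂ : Sym2 V → Option ℕ) (u v z : V)
    (h : ∀ a, (localAvailable G c₂ a \ localAvailable G c₁ a).card +
        ((if a = u then 1 else 0) + (if a = v then 1 else 0)) ≤
      (localAvailable G c₁ a \ localAvailable G c₂ a).card + (if a = z then 1 else 0)) :
    potential G c₂ + 1 ≤ potential G c₁ := by
  have key : ∀ a, (localAvailable G c₂ a).card +
        ((if a = u then 1 else 0) + (if a = v then 1 else 0)) ≤
      (localAvailable G c₁ a).card + (if a = z then 1 else 0) := by
    intro a
    have h₁ := Finset.card_sdiff_add_card (localAvailable G c₁ a) (localAvailable G c₂ a)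
    have h₂ := Finset.card_sdiff_add_card (localAvailable G c₂ a) (localAvailable G c₁ a)
    rw [Finset.union_comm] at h₂
    have := h a
    omega
  have := Finset.sum_le_sum fun a (_ : a ∈ Finset.univ) => key a
  simp only [Finset.sum_add_distrib, Finset.sum_ite_eq', Finset.mem_univ, if_true] at this
  rw [potential_eq_sum_card_localAvailable, potential_eq_sum_card_localAvailable]
  omega

/-- **Shifting a truncated strictly local Vizing chain drops the potential by at least
one.** Here the chain consists of the strictly local fan `(u w 0, …, u w (k-1))` on the
uncoloured edge `u v` followed by the portion of the `(κ₁,κ₂)`-bichromatic path starting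
at `w (k-1)` up to and including its first edge (the edge between `x t` and `x (t+1)`)
that would violate strict locality after the shift; `c₂` is the post-shift colouring. -/
theorem potential_chain_shift (V : Type*) [Fintype V] [DecidableEq V]
    (G : SimpleGraph V) [DecidableRel G.Adj]
    (c₁ c₂ : Sym2 V → Option ℕ)
    (hc₁ : IsProperPartialVizing G c₁) (hsl : StrictlyLocal G c₁)
    (u v : V) (huv : G.Adj u v) (hun : c₁ s(u, v) = none)
    (w : ℕ → V) (k : ℕ) (hfan : IsFan G c₁ u w k) (hw0 : w 0 = v)
    (hslfan : ∀ i β, i + 1 < k → c₁ s(u, w (i + 1)) = some β → β ≤ G.degree (w i) + 1)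
    (i : ℕ) (hik : i + 1 < k) (κ₁ κ₂ : ℕ)
    (hκ₂rep : c₁ s(u, w (i + 1)) = some κ₂)
    (hκ₂wk : Available G c₁ (w (k - 1)) κ₂) (hκ₂d : κ₂ ≤ G.degree (w (k - 1)) + 1)
    (hκ₂u : ¬ Available G c₁ u κ₂)
    (hκ₁u : Available G c₁ u κ₁) (hκ₁d : κ₁ ≤ G.degree u + 1)
    (x : ℕ → V) (m : ℕ) (hx0 : x 0 = w (k - 1))
    (hpath : IsBichromPathFrom G c₁ κ₁ κ₂ x m)
    (t : ℕ) (htm : t < m)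
    (hviol : max (G.degree (x t)) (G.degree (x (t + 1))) + 1 <
      (if Even t then κ₂ else κ₁))
    (hfirst : ∀ j < t, ¬ (max (G.degree (x j)) (G.degree (x (j + 1))) + 1 <
      (if Even j then κ₂ else κ₁)))
    -- `c₂` is obtained from `c₁` by shifting the chain
    -- `(u w 0, …, u w (k-1), x 0 x 1, …, x t x (t+1))`:
    (hshiftFan : ∀ j, j + 1 < k → c₂ s(u, w j) = c₁ s(u, w (j + 1)))
    (hshiftJunction : c₂ s(u, w (k - 1)) = some κ₁)
    (hshiftPath : ∀ j < t, c₂ s(x j, x (j + 1)) = some (if Even j then κ₂ else κ₁))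
    (hshiftLast : c₂ s(x t, x (t + 1)) = none)
    (hshiftRest : ∀ f, (∀ j < k, f ≠ s(u, w j)) →
      (∀ j, j ≤ t → f ≠ s(x j, x (j + 1))) → c₂ f = c₁ f) :
    potential G c₂ + 1 ≤ potential G c₁ := by
  obtain ⟨hwinj, hadj, -, hrep⟩ := hfan
  obtain ⟨-, hxadj, hxcol, -⟩ := hpath
  obtain ⟨⟨hpos, -⟩, -⟩ := hc₁
  subst hw0
  have ht : 0 < t := by
    rcases Nat.eq_zero_or_pos t with rfl | h
    · simp only [Even.zero, if_true] at hviol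
      rw [← hx0] at hκ₂d
      have := le_max_left (G.degree (x 0)) (G.degree (x (0 + 1)))
      omega
    · exact h
  have hκ₁pos : 1 ≤ κ₁ := (hpos s(x 0, x 1) κ₁ (by simpa using hxcol 0 (by omega))).2
  have hκ₂pos : 1 ≤ κ₂ := (hpos _ _ hκ₂rep).2
  -- every newly available local colour comes from a fan leaf or from the end of the path
  have hgain : ∀ a, ∀ κ ∈ localAvailable G c₂ a \ localAvailable G c₁ a,
      (∃ j < k, a = w j ∧ c₁ s(u, w j) = some κ) ∨
      (a = x (t + 1) ∧ κ = if Even t then κ₁ else κ₂) := by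
    intro a κ hκ
    simp only [Finset.mem_sdiff, mem_localAvailable, not_and] at hκ
    obtain ⟨⟨hκd, hav₂⟩, hav₁⟩ := hκ
    have hnot := hav₁ hκd
    simp only [Available, not_forall, not_not] at hnot
    obtain ⟨y, hay, hy⟩ := hnot
    by_cases hF : ∃ j < k, s(a, y) = s(u, w j)
    · obtain ⟨j, hj, he⟩ := hF
      rw [he] at hy
      rcases Sym2.eq_iff.1 he with ⟨rfl, rfl⟩ | ⟨rfl, rfl⟩
      · obtain _ | j := j
        · simp [hun] at hy
        · exact absurd ((hshiftFan j hj).trans hy) (hav₂ _ (hadj j (by omega)))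
      · exact .inl ⟨j, hj, rfl, hy⟩
    by_cases hP : ∃ l ≤ t, s(a, y) = s(x l, x (l + 1))
    · obtain ⟨l, hl, he⟩ := hP
      rw [he, hxcol l (by omega), Option.some_inj] at hy
      subst hy
      rcases Sym2.eq_iff.1 he with ⟨rfl, rfl⟩ | ⟨rfl, rfl⟩
      · obtain _ | l := l
        · refine absurd ?_ (hav₂ u (by rw [hx0]; exact (hadj _ (by omega)).symm))
          rw [Sym2.eq_swap, hx0, hshiftJunction]
          simp
        · refine absurd ?_ (hav₂ (x l) (hxadj l (by omega)).symm)
          rw [Sym2.eq_swap, hshiftPath l (by omega)]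
          by_cases hpar : Even l <;> simp [hpar, Nat.even_add_one]
      · rcases lt_trichotomy (l + 1) t with hlt | rfl | hgt
        · refine absurd ?_ (hav₂ (x (l + 1 + 1)) (hxadj (l + 1) (by omega)))
          rw [hshiftPath (l + 1) hlt]
          by_cases hpar : Even l <;> simp [hpar, Nat.even_add_one]
        · exfalso
          have := le_max_left (G.degree (x (l + 1))) (G.degree (x (l + 1 + 1)))
          by_cases hpar : Even l <;> simp [hpar, Nat.even_add_one] at hviol hκd <;> omega
        · obtain rfl : l = t := by omega
          exact .inr ⟨rfl, rfl⟩
    · push Not at hF hP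
      exact absurd ((hshiftRest _ hF hP).trans hy) (hav₂ y hay)
  have hlossu : 1 ≤ (localAvailable G c₁ u \ localAvailable G c₂ u).card := by
    refine Finset.card_pos.2 ⟨κ₁, ?_⟩
    simp only [Finset.mem_sdiff, mem_localAvailable, not_and]
    exact ⟨⟨⟨hκ₁pos, hκ₁d⟩, hκ₁u⟩, fun _ h => h _ (hadj (k - 1) (by omega)) hshiftJunction⟩
  have hlossw : ∀ j < k,
      1 ≤ (localAvailable G c₁ (w j) \ localAvailable G c₂ (w j)).card := by
    intro j hj
    refine Finset.card_pos.2 ?_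
    simp only [Finset.Nonempty, Finset.mem_sdiff, mem_localAvailable, not_and]
    by_cases hjk : j + 1 < k
    · obtain ⟨β, hβ, hβav⟩ := hrep j hjk
      refine ⟨β, ⟨⟨(hpos _ _ hβ).2, hslfan j β hjk hβ⟩, hβav⟩, fun _ h => ?_⟩
      refine h u (hadj j hj).symm ?_
      rw [Sym2.eq_swap, hshiftFan j hjk, hβ]
    · obtain rfl : j = k - 1 := by omega
      refine ⟨κ₂, ⟨⟨hκ₂pos, hκ₂d⟩, hκ₂wk⟩, fun _ h => ?_⟩
      rw [← hx0] at h
      exact h (x 1) (hxadj 0 (by omega)) (by simpa using hshiftPath 0 ht)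
  refine potential_add_one_le G c₁ c₂ u (w 0) (x (t + 1)) fun a => ?_
  set α := if Even t then κ₁ else κ₂
  have hend : (if a = x (t + 1) then ({α} : Finset ℕ) else ∅).card =
      if a = x (t + 1) then 1 else 0 := by split_ifs <;> simp
  rw [← hend]
  by_cases hleaf : ∃ j < k, a = w j ∧ j ≠ 0
  · obtain ⟨j, hj, rfl, hj0⟩ := hleaf
    have hu : w j ≠ u := (hadj j hj).ne'
    have hw : w j ≠ w 0 := fun h =>
      hj0 (hwinj (Set.mem_Iio.2 hj) (Set.mem_Iio.2 (by omega)) h)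
    obtain ⟨j, rfl⟩ := Nat.exists_eq_add_one_of_ne_zero hj0
    obtain ⟨β, hβ, -⟩ := hrep j hj
    have hsub : localAvailable G c₂ (w (j + 1)) \ localAvailable G c₁ (w (j + 1)) ⊆
        insert β (if w (j + 1) = x (t + 1) then {α} else ∅) := by
      intro κ hκ
      rcases hgain _ κ hκ with ⟨l, hl, hwl, hlκ⟩ | ⟨hz, hκα⟩
      · rw [← hwl, hβ, Option.some_inj] at hlκ
        simp [hlκ]
      · simp [hz, hκα]
    have h₁ := Finset.card_le_card hsub
    have h₂ := Finset.card_insert_le β (if w (j + 1) = x (t + 1) then {α} else ∅)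
    have h₃ := hlossw _ hj
    rw [if_neg hu, if_neg hw]
    omega
  · have hsub : localAvailable G c₂ a \ localAvailable G c₁ a ⊆
        if a = x (t + 1) then {α} else ∅ := by
      intro κ hκ
      rcases hgain _ κ hκ with ⟨l, hl, hwl, hlκ⟩ | ⟨hz, hκα⟩
      · by_cases hl0 : l = 0
        · simp [hl0, hun] at hlκ
        · exact absurd ⟨l, hl, hwl, hl0⟩ hleaf
      · simp [hz, hκα]
    have h₁ := Finset.card_le_card hsub
    by_cases hau : a = u
    · subst hau
      rw [if_pos rfl, if_neg huv.ne]
      omega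
    · rw [if_neg hau]
      by_cases haw : a = w 0
      · have := hlossw 0 (by omega)
        rw [if_pos haw]
        rw [haw] at h₁ ⊢
        omega
      · rw [if_neg haw]
        omega
end

section
/- Let Δ ≥ 1, let c be a proper partial (Δ+1)-edge colouring of a finite simple graph G of maximum degree Δ, and let S be a set of Vizing chains with respect to c such that distinct chains in S are constructed on distinct vertices. Then every coloured edge of G is an edge of at most 4Δ² of the Vizing chains in S. -/
open SimpleGraph

variable {V : Type*}

/-- A Vizing chain on the uncoloured edge `u v` with respect to `c`: a fan
`(u w 0, …, u w (k-1))` with `w 0 = v`, colours `κ₁ ∈ A(u)` and `κ₂ ∈ A(w (k-1))`, and a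
(possibly empty) initial segment `x 0, …, x t` of the `(κ₁,κ₂)`-bichromatic path having
`w (k-1)` as an endpoint, traversed starting from `w (k-1)`.  The chain is said to be
constructed on the vertex `u`. -/
structure VizingChain (G : SimpleGraph V) (c : Sym2 V → Option ℕ) where
  u : V
  v : V
  w : ℕ → V
  k : ℕ
  κ₁ : ℕ
  κ₂ : ℕ
  x : ℕ → V
  t : ℕ
  k_pos : 1 ≤ k
  fan : IsFan G c u w k
  w0 : w 0 = v
  avail₁ : Available G c u κ₁
  avail₂ : Available G c (w (k - 1)) κ₂
  x0 : x 0 = w (k - 1)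
  path_inj : Set.InjOn x (Set.Iic t)
  path_adj : ∀ j < t, G.Adj (x j) (x (j + 1))
  path_col : ∀ j < t, c s(x j, x (j + 1)) = some (if Even j then κ₁ else κ₂)

/-- `e` is an edge of the Vizing chain `C` (a fan edge or an edge of its bichromatic
path segment). -/
def VizingChain.HasEdge {G : SimpleGraph V} {c : Sym2 V → Option ℕ}
    (C : VizingChain G c) (e : Sym2 V) : Prop :=
  (∃ i < C.k, e = s(C.u, C.w i)) ∨ (∃ j < C.t, e = s(C.x j, C.x (j + 1)))

/-- In a proper partial colouring, each vertex has at most one neighbour along each colour. -/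
theorem IsProperPartial.neighbor_unique {G : SimpleGraph V} {c : Sym2 V → Option ℕ}
    (hc : IsProperPartial G c) {p x y : V} {κ : ℕ}
    (hx : c s(p, x) = some κ) (hy : c s(p, y) = some κ) : x = y := by
  by_contra hxy
  exact hc.2 s(p, x) s(p, y) κ (fun h => hxy (Sym2.congr_right.1 h))
    ⟨p, Sym2.mem_mk_left _ _, Sym2.mem_mk_left _ _⟩ hx hy

namespace VizingChain

variable {G : SimpleGraph V} {c : Sym2 V → Option ℕ}

/-- The colour of the `j`-th edge of the bichromatic path of a Vizing chain. -/
def pathColor (C : VizingChain G c) (j : ℕ) : ℕ := if Even j then C.κ₁ else C.κ₂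

theorem pathColor_pair (C : VizingChain G c) (j : ℕ) :
    s(C.pathColor j, C.pathColor (j + 1)) = s(C.κ₁, C.κ₂) := by
  by_cases h : Even j <;> simp [pathColor, h, Nat.even_add_one, Sym2.eq_swap]

theorem color_path_edge (C : VizingChain G c) {j : ℕ} (hj : j < C.t) :
    c s(C.x j, C.x (j + 1)) = some (C.pathColor j) :=
  C.path_col j hj

theorem colors_ne (C : VizingChain G c) (ht : 0 < C.t) : C.κ₁ ≠ C.κ₂ := by
  intro h
  refine C.avail₂ (C.x 1) (C.x0 ▸ C.path_adj 0 ht) ?_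
  simpa [pathColor, C.x0, h] using C.color_path_edge ht

theorem adj_start (C : VizingChain G c) : G.Adj (C.x 0) C.u :=
  C.x0 ▸ (C.fan.2.1 _ (Nat.sub_one_lt (Nat.one_le_iff_ne_zero.1 C.k_pos))).symm

theorem pathColor_eq_of_edge_eq {C C' : VizingChain G c} {j j' : ℕ} (hj : j < C.t)
    (hj' : j' < C'.t) (h₀ : C.x j = C'.x j') (h₁ : C.x (j + 1) = C'.x (j' + 1)) :
    C.pathColor j = C'.pathColor j' := by
  have h := C.color_path_edge hj
  rw [h₀, h₁, C'.color_path_edge hj'] at h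
  exact (Option.some.inj h).symm

/-- A bichromatic path cannot be extended backwards beyond the start of a Vizing chain path. -/
theorem not_extends_start {C C' : VizingChain G c}
    (hcols : s(C.κ₁, C.κ₂) = s(C'.κ₁, C'.κ₂)) {j : ℕ} (ht : 0 < C.t) (hj : j + 1 < C'.t)
    (h₀ : C.x 0 = C'.x (j + 1)) (h₁ : C.x 1 = C'.x (j + 2)) : False := by
  have hcol := pathColor_eq_of_edge_eq ht hj h₀ h₁
  have hpair := C'.pathColor_pair j
  have hfirst : C.pathColor 0 = C.κ₁ := by simp [pathColor]
  rw [← hcol, ← hcols, hfirst, Sym2.eq_swap, Sym2.congr_right] at hpair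
  have hlt : j < C'.t := by lia
  refine C.avail₂ (C'.x j) ?_ ?_
  · rw [← C.x0, h₀]
    exact (C'.path_adj j hlt).symm
  · rw [← C.x0, h₀, Sym2.eq_swap, C'.color_path_edge hlt, hpair]

/-- Vizing chains using the same pair of colours and traversing a common path edge in the same
direction have paths with the same starting vertex. -/
theorem start_eq_of_edge_eq (hc : IsProperPartial G c) {C C' : VizingChain G c}
    (hcols : s(C.κ₁, C.κ₂) = s(C'.κ₁, C'.κ₂)) {j j' : ℕ} (hj : j < C.t) (hj' : j' < C'.t)
    (h₀ : C.x j = C'.x j') (h₁ : C.x (j + 1) = C'.x (j' + 1)) : C.x 0 = C'.x 0 := by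
  induction j generalizing j' with
  | zero =>
    cases j' with
    | zero => exact h₀
    | succ j' => exact (not_extends_start hcols hj hj' h₀ h₁).elim
  | succ j ih =>
    cases j' with
    | zero => exact (not_extends_start hcols.symm hj' hj h₀.symm h₁.symm).elim
    | succ j' =>
      have hlt : j < C.t := by lia
      have hlt' : j' < C'.t := by lia
      have hcol := pathColor_eq_of_edge_eq hj hj' h₀ h₁
      have hpair := (C.pathColor_pair j).trans (hcols.trans (C'.pathColor_pair j').symm)
      rw [hcol, Sym2.congr_left] at hpair
      have hx := C.color_path_edge hlt
      have hx' := C'.color_path_edge hlt'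
      rw [Sym2.eq_swap, h₀, hpair] at hx
      rw [Sym2.eq_swap] at hx'
      exact ih hlt hlt' (hc.neighbor_unique hx hx') h₀

theorem exists_common_start (hc : IsProperPartial G c) (κ : Sym2 ℕ) (p q : V) :
    ∃ z, ∀ C : VizingChain G c, s(C.κ₁, C.κ₂) = κ →
      ∀ j < C.t, C.x j = p → C.x (j + 1) = q → C.x 0 = z := by
  by_cases h : ∃ C : VizingChain G c, s(C.κ₁, C.κ₂) = κ ∧
      ∃ j < C.t, C.x j = p ∧ C.x (j + 1) = q
  · obtain ⟨C, hC, j, hj, h₀, h₁⟩ := h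
    exact ⟨C.x 0, fun C' hC' j' hj' h₀' h₁' => start_eq_of_edge_eq hc (hC'.trans hC.symm)
      hj' hj (h₀'.trans h₀.symm) (h₁'.trans h₁.symm)⟩
  · exact ⟨p, fun C hC j hj h₀ h₁ => (h ⟨C, hC, j, hj, h₀, h₁⟩).elim⟩

/-- A Vizing chain whose path has an edge of colour `β` other than its first edge uses `β` and
another colour of the palette. -/
theorem exists_other_color [Fintype V] [DecidableRel G.Adj] (hc : IsProperPartialVizing G c)
    (C : VizingChain G c) {j β : ℕ} (hj : j + 1 < C.t) (hβ : C.pathColor (j + 1) = β) :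
    ∃ γ ∈ (Finset.Icc 1 (G.maxDegree + 1)).erase β, s(C.κ₁, C.κ₂) = s(β, γ) := by
  have hlt : j < C.t := by lia
  have hcol := C.color_path_edge hlt
  have hpair := C.pathColor_pair j
  refine ⟨C.pathColor j, Finset.mem_erase.2 ⟨fun h => ?_, Finset.mem_Icc.2
    ⟨(hc.1.1 _ _ hcol).2, hc.2 _ _ hcol⟩⟩, ?_⟩
  · refine C.colors_ne (by lia) ?_
    rw [h, hβ] at hpair
    rcases Sym2.eq_iff.1 hpair with ⟨h₁, h₂⟩ | ⟨h₂, h₁⟩ <;>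
      exact h₁.symm.trans h₂
  · rw [← hpair, hβ, Sym2.eq_swap]

end VizingChain

/-- **Packing lemma.** If `S` is a (finite) set of Vizing chains constructed on pairwise
distinct vertices in a graph of maximum degree `Δ ≥ 1`, then every coloured edge of `G`
belongs to at most `4Δ²` of the chains in `S`. -/
theorem vizing_chain_packing (V : Type*) [Fintype V] [DecidableEq V]
    (G : SimpleGraph V) [DecidableRel G.Adj] (hΔ : 1 ≤ G.maxDegree)
    (c : Sym2 V → Option ℕ) (hc : IsProperPartialVizing G c)
    (S : Set (VizingChain G c)) (hS : S.Finite)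
    (hdistinct : ∀ C ∈ S, ∀ C' ∈ S, VizingChain.u C = VizingChain.u C' → C = C')
    (e : Sym2 V) (he : e ∈ G.edgeSet) (hcol : c e ≠ none) :
    {C ∈ S | C.HasEdge e}.ncard ≤ 4 * G.maxDegree ^ 2 := by
  classical
  obtain ⟨β, hβ⟩ := Option.ne_none_iff_exists'.1 hcol
  induction e using Sym2.ind with
  | _ a b =>
  have hab : G.Adj a b := he
  have hbound (v : V) : (G.neighborFinset v).card ≤ G.maxDegree := by
    simpa using G.degree_le_maxDegree v
  choose z hz using VizingChain.exists_common_start hc.1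
  let P := (Finset.Icc 1 (G.maxDegree + 1)).erase β
  let near := G.neighborFinset a ∪ G.neighborFinset b
  let far := P.biUnion fun γ =>
    G.neighborFinset (z s(β, γ) a b) ∪ G.neighborFinset (z s(β, γ) b a)
  have hnear : near.card ≤ 2 * G.maxDegree :=
    (Finset.card_union_le _ _).trans (by linarith [hbound a, hbound b])
  have hP : P.card = G.maxDegree := by
    have hmem : β ∈ Finset.Icc 1 (G.maxDegree + 1) :=
      Finset.mem_Icc.2 ⟨(hc.1.1 _ _ hβ).2, hc.2 _ _ hβ⟩
    simp [P, Finset.card_erase_of_mem hmem]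
  have hfar : far.card ≤ G.maxDegree * (2 * G.maxDegree) := by
    rw [← hP]
    refine Finset.card_biUnion_le_card_mul _ _ _ fun γ _ => ?_
    rw [hP]
    exact (Finset.card_union_le _ _).trans
      (by linarith [hbound (z s(β, γ) a b), hbound (z s(β, γ) b a)])
  have hmaps : ∀ C ∈ {C ∈ S | C.HasEdge s(a, b)}, C.u ∈ ((near ∪ far : Finset V) : Set V) := by
    rintro C ⟨-, ⟨i, hi, h⟩ | ⟨j, hj, h⟩⟩
    · refine Finset.mem_union_left _ ?_
      rcases Sym2.eq_iff.1 h with ⟨h₀, -⟩ | ⟨-, h₀⟩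
      · simp [near, ← h₀, hab.symm]
      · simp [near, ← h₀, hab]
    · cases j with
      | zero =>
        refine Finset.mem_union_left _ ?_
        have hadj := C.adj_start
        rcases Sym2.eq_iff.1 h with ⟨h₀, -⟩ | ⟨-, h₀⟩
        · simp [near, h₀, hadj]
        · simp [near, h₀, hadj]
      | succ j =>
        refine Finset.mem_union_right _ ?_
        have hpc : C.pathColor (j + 1) = β := by
          rw [h, C.color_path_edge hj] at hβ
          exact Option.some.inj hβ
        obtain ⟨γ, hγ, hcols⟩ := C.exists_other_color hc hj hpc
        refine Finset.mem_biUnion.2 ⟨γ, hγ, ?_⟩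
        have hadj := C.adj_start
        rcases Sym2.eq_iff.1 h with ⟨h₀, h₁⟩ | ⟨h₁, h₀⟩
        · rw [hz _ _ _ C hcols _ hj h₀.symm h₁.symm] at hadj
          simp [hadj]
        · rw [hz _ _ _ C hcols _ hj h₀.symm h₁.symm] at hadj
          simp [hadj]
  have hcard := Set.ncard_le_ncard_of_injOn VizingChain.u hmaps
    (fun C hC C' hC' h => hdistinct C hC.1 C' hC'.1 h) (Finset.finite_toSet _)
  rw [Set.ncard_coe_finset] at hcard
  have hunion := Finset.card_union_le near far
  nlinarith
end

section
/- Let 0 < ε ≤ 1, let c be a proper partial edge colouring of a finite simple graph G, and let v be a vertex of G with d(v) ≥ 1. For each integer i ≥ 0 let I_i = {κ ∈ ℕ : 2^i ≤ κ < 2^{i+1}}. Then there exists an i ≥ 0 such that |A(v) ∩ {1,…,⌈(1+ε)d(v)⌉} ∩ I_i| ≥ ε·|I_i|/4, i.e., v is ε-dense in the interval I_i. -/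
open SimpleGraph

variable {V : Type*}

/-- **Every vertex is `ε`-dense in some dyadic interval.** For a vertex `v` of positive
degree there is an `i ≥ 0` with
`|A_ε(v) ∩ I_i| ≥ ε |I_i| / 4`, where `I_i = {κ : 2^i ≤ κ < 2^{i+1}}` and
`A_ε(v) = A(v) ∩ {1, …, ⌈(1+ε) d(v)⌉}`. -/
theorem eps_dense_interval (V : Type*) [Fintype V] [DecidableEq V]
    (G : SimpleGraph V) [DecidableRel G.Adj]
    (ε : ℝ) (hε0 : 0 < ε) (hε1 : ε ≤ 1)
    (c : Sym2 V → Option ℕ) (hc : IsProperPartial G c)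
    (v : V) (hd : 1 ≤ G.degree v) :
    ∃ i : ℕ,
      ε * ((Finset.Ico (2 ^ i) (2 ^ (i + 1))).card : ℝ) / 4 ≤
        (({κ : ℕ | Available G c v κ ∧
            κ ∈ Finset.Icc 1 ⌈(1 + ε) * (G.degree v : ℝ)⌉₊ ∧
            κ ∈ Finset.Ico (2 ^ i) (2 ^ (i + 1))}).ncard : ℝ) := by
  classical
  by_contra! hsparse
  set d := G.degree v with hd_def
  set N := ⌈(1 + ε) * (d : ℝ)⌉₊ with hN_def
  have hd_one : (1 : ℝ) ≤ d := by exact_mod_cast hd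
  have hN_lower : (1 + ε) * (d : ℝ) ≤ N := Nat.le_ceil _
  have hN_upper : N ≤ 2 * d := by
    apply Nat.ceil_le.mpr
    push_cast
    nlinarith
  have hN_ne : N ≠ 0 := by
    intro h
    rw [h] at hN_lower
    push_cast at hN_lower
    nlinarith
  let F : Finset ℕ := (G.neighborFinset v).image fun x => (c s(v, x)).getD 0
  have hF : F.card ≤ d := Finset.card_image_le
  let A : Finset ℕ := Finset.Icc 1 N \ F
  have hA : N ≤ A.card + d := by
    have h := Finset.le_card_sdiff F (Finset.Icc 1 N)
    simp only [Nat.card_Icc] at h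
    change _ ≤ A.card at h
    omega
  have hA_available : ∀ κ ∈ A, Available G c v κ := by
    intro κ hκ x hx hcx
    refine (Finset.mem_sdiff.mp hκ).2 (Finset.mem_image.mpr ⟨x, ?_, ?_⟩)
    · simpa using hx
    · simp [hcx]
  have hA_interval : ∀ i : ℕ,
      ((A.filter fun κ => κ ∈ Finset.Ico (2 ^ i) (2 ^ (i + 1))).card : ℝ) ≤ ε / 4 * 2 ^ i := by
    intro i
    have hi := hsparse i
    have hcard : (Finset.Ico (2 ^ i) (2 ^ (i + 1))).card = 2 ^ i := by
      rw [Nat.card_Ico, pow_succ]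
      omega
    rw [hcard] at hi
    push_cast at hi
    have hle : (A.filter fun κ => κ ∈ Finset.Ico (2 ^ i) (2 ^ (i + 1))).card ≤
        ({κ : ℕ | Available G c v κ ∧ κ ∈ Finset.Icc 1 N ∧
          κ ∈ Finset.Ico (2 ^ i) (2 ^ (i + 1))}).ncard := by
      rw [← Set.ncard_coe_finset]
      refine Set.ncard_le_ncard ?_ ((Finset.Icc 1 N).finite_toSet.subset fun κ hκ => hκ.2.1)
      intro κ hκ
      obtain ⟨hκA, hκI⟩ := Finset.mem_filter.mp hκ
      exact ⟨hA_available κ hκA, (Finset.mem_sdiff.mp hκA).1, hκI⟩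
    have hle_real := (Nat.cast_le (α := ℝ)).mpr hle
    linarith
  have hA_cover : A ⊆ (Finset.range (Nat.log 2 N + 1)).biUnion
      fun i => A.filter fun κ => κ ∈ Finset.Ico (2 ^ i) (2 ^ (i + 1)) := by
    intro κ hκ
    obtain ⟨hκ_one, hκ_le⟩ := Finset.mem_Icc.mp (Finset.mem_sdiff.mp hκ).1
    refine Finset.mem_biUnion.mpr ⟨Nat.log 2 κ, ?_, Finset.mem_filter.mpr ⟨hκ, ?_⟩⟩
    · exact Finset.mem_range.mpr (Nat.lt_succ_of_le (Nat.log_mono_right hκ_le))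
    · exact Finset.mem_Ico.mpr
        ⟨Nat.pow_log_le_self 2 (by omega), Nat.lt_pow_succ_log_self (by norm_num) κ⟩
  have hA_upper : (A.card : ℝ) ≤ ε / 4 * (2 ^ (Nat.log 2 N + 1) - 1) := by
    calc (A.card : ℝ)
        ≤ ∑ i ∈ Finset.range (Nat.log 2 N + 1),
            ((A.filter fun κ => κ ∈ Finset.Ico (2 ^ i) (2 ^ (i + 1))).card : ℝ) := by
          exact_mod_cast (Finset.card_le_card hA_cover).trans Finset.card_biUnion_le
      _ ≤ ∑ i ∈ Finset.range (Nat.log 2 N + 1), ε / 4 * 2 ^ i :=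
          Finset.sum_le_sum fun i _ => hA_interval i
      _ = ε / 4 * (2 ^ (Nat.log 2 N + 1) - 1) := by
          rw [← Finset.mul_sum, geom_sum_eq (by norm_num)]
          norm_num
  have hpow : (2 : ℝ) ^ (Nat.log 2 N + 1) ≤ 4 * d := by
    have h := Nat.pow_log_le_self 2 hN_ne
    have h' : 2 ^ (Nat.log 2 N + 1) ≤ 4 * d := by
      rw [pow_succ]
      omega
    exact_mod_cast h'
  have hA_real : (N : ℝ) ≤ A.card + d := by exact_mod_cast hA
  nlinarith
end

section
/- There is an absolute constant C such that the following holds. Let G be a finite simple graph on n ≥ 2 vertices with maximum degree Δ ≥ 2, let 0 < ε ≤ 1, and let c be any proper partial edge colouring of G. Then there exists a set S ⊆ {1,…,⌈(1+ε)Δ⌉} with |S| ≤ C·(log n · log Δ)/ε such that every vertex v of G with d(v) ≥ 1 has an available colour in S ∩ {1,…,⌈(1+ε)d(v)⌉}; that is, there exists an ε-local palette of size at most C·(log n · log Δ)/ε. -/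
open SimpleGraph

variable {V : Type*}

/-- Greedy step count: `k` points of `U` can be chosen so that at most a `(1 - p) ^ k` fraction
of the sets `A v`, each of density at least `p` in `U`, is missed. -/
lemma exists_finset_card_filter_disjoint_le {α β : Type*} [DecidableEq β]
    (X : Finset α) (U : Finset β) (hU : U.Nonempty) (A : α → Finset β) (p : ℝ) (hp : p ≤ 1)
    (hA : ∀ v ∈ X, A v ⊆ U) (hcard : ∀ v ∈ X, p * (U.card : ℝ) ≤ ((A v).card : ℝ)) (k : ℕ) :
    ∃ S : Finset β, S.card ≤ k ∧
      (((X.filter fun v => Disjoint (A v) S).card : ℕ) : ℝ) ≤ (1 - p) ^ k * (X.card : ℝ) := by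
  induction k with
  | zero => exact ⟨∅, by simp⟩
  | succ k ih =>
    obtain ⟨S, hS, hT⟩ := ih
    set T := X.filter fun v => Disjoint (A v) S with hTdef
    have hdouble : ∑ κ ∈ U, (((T.filter fun v => κ ∈ A v).card : ℕ) : ℝ)
        = ∑ v ∈ T, ((A v).card : ℝ) := by
      have h := Finset.sum_card_bipartiteAbove_eq_sum_card_bipartiteBelow
        (s := T) (t := U) (fun v κ => κ ∈ A v)
      have h' : ∀ v ∈ T, (U.bipartiteAbove (fun v κ => κ ∈ A v) v) = A v := by
        intro v hv
        have := hA v (Finset.mem_filter.1 hv).1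
        ext κ
        simp only [Finset.mem_bipartiteAbove]
        exact ⟨fun h => h.2, fun h => ⟨this h, h⟩⟩
      rw [Finset.sum_congr rfl fun v hv => by rw [h' v hv]] at h
      exact_mod_cast h.symm
    have hsum : ∑ κ ∈ U, p * (T.card : ℝ)
        ≤ ∑ κ ∈ U, (((T.filter fun v => κ ∈ A v).card : ℕ) : ℝ) := by
      rw [hdouble]
      calc ∑ κ ∈ U, p * (T.card : ℝ) = ∑ v ∈ T, p * (U.card : ℝ) := by
            simp only [Finset.sum_const, nsmul_eq_mul]; ring
        _ ≤ _ := Finset.sum_le_sum fun v hv => hcard v (Finset.mem_filter.1 hv).1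
    obtain ⟨κ, -, hκ⟩ := Finset.exists_le_of_sum_le hU hsum
    refine ⟨insert κ S, (Finset.card_insert_le _ _).trans (by omega), ?_⟩
    have hset : (X.filter fun v => Disjoint (A v) (insert κ S))
        = T.filter fun v => ¬ κ ∈ A v := by
      ext v
      simp only [hTdef, Finset.mem_filter, Finset.disjoint_insert_right]
      tauto
    have hsplit := Finset.card_filter_add_card_filter_not (s := T) (fun v => κ ∈ A v)
    have hsplit' : (((T.filter fun v => κ ∈ A v).card : ℕ) : ℝ)
        + ((T.filter fun v => ¬ κ ∈ A v).card : ℕ) = T.card := by exact_mod_cast hsplit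
    rw [hset, pow_succ]
    have := mul_le_mul_of_nonneg_left hT (sub_nonneg.2 hp)
    nlinarith

/-- At most `n` sets of density at least `p` in `U` have a hitting set of size `3 log n / p`. -/
lemma exists_hitting_set_card_le {α β : Type*} [DecidableEq β]
    (X : Finset α) (U : Finset β) (hU : U.Nonempty) (A : α → Finset β) (p : ℝ) (hp0 : 0 < p)
    (hp : p ≤ 1) (hA : ∀ v ∈ X, A v ⊆ U)
    (hcard : ∀ v ∈ X, p * (U.card : ℝ) ≤ ((A v).card : ℝ))
    (n : ℕ) (hn : 2 ≤ n) (hX : X.card ≤ n) :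
    ∃ S : Finset β, (S.card : ℝ) ≤ 3 * Real.log n / p ∧ ∀ v ∈ X, ∃ κ ∈ S, κ ∈ A v := by
  have hn' : (2 : ℝ) ≤ n := by exact_mod_cast hn
  have hlog : 1 / 2 < Real.log n := by
    have := Real.log_two_gt_d9
    have := Real.log_le_log (by norm_num) hn'
    linarith
  obtain ⟨S, hS, hT⟩ := exists_finset_card_filter_disjoint_le X U hU A p hp hA hcard
    (⌊Real.log n / p⌋₊ + 1)
  have hfloor := Nat.floor_le (a := Real.log n / p) (by positivity)
  have hlt := Nat.lt_floor_add_one (Real.log n / p)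
  set k := ⌊Real.log n / p⌋₊
  refine ⟨S, ?_, ?_⟩
  · have h1 : (S.card : ℝ) ≤ k + 1 := by exact_mod_cast hS
    have h2 : 1 ≤ 2 * (Real.log n / p) := by
      rw [← mul_div_assoc, le_div_iff₀ hp0]; linarith
    calc (S.card : ℝ) ≤ 3 * (Real.log n / p) := by linarith
      _ = _ := by ring
  · have hsmall : (1 - p) ^ (k + 1) * (X.card : ℝ) < 1 := by
      calc (1 - p) ^ (k + 1) * (X.card : ℝ) ≤ Real.exp (-p) ^ (k + 1) * n := by
            gcongr
            exact Real.one_sub_le_exp_neg p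
        _ = Real.exp (-p * (k + 1)) * n := by
            rw [← Real.exp_nat_mul]; push_cast; ring_nf
        _ < Real.exp (-Real.log n) * n := by
            have : Real.log n < (k + 1) * p := (div_lt_iff₀ hp0).1 hlt
            gcongr
            linarith
        _ = 1 := by
            rw [Real.exp_neg, Real.exp_log (by linarith)]
            field_simp
    have h0 : (X.filter fun v => Disjoint (A v) S).card = 0 := by
      have : (((X.filter fun v => Disjoint (A v) S).card : ℕ) : ℝ) < 1 := hT.trans_lt hsmall
      exact Nat.lt_one_iff.1 (by exact_mod_cast this)
    intro v hv
    have : ¬ Disjoint (A v) S := Finset.filter_eq_empty_iff.1 (Finset.card_eq_zero.1 h0) hv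
    obtain ⟨κ, h1, h2⟩ := Finset.not_disjoint_iff.1 this
    exact ⟨κ, h2, h1⟩

/-- A vertex of degree `d` has at least `ε d` available colours among `1, …, ⌈(1 + ε) d⌉`. -/
lemma exists_available_finset [Fintype V] [DecidableEq V] (G : SimpleGraph V)
    [DecidableRel G.Adj] (c : Sym2 V → Option ℕ) (ε : ℝ) (v : V) :
    ∃ A : Finset ℕ, A ⊆ Finset.Icc 1 ⌈(1 + ε) * (G.degree v : ℝ)⌉₊ ∧
      (∀ κ ∈ A, Available G c v κ) ∧ ε * (G.degree v : ℝ) ≤ A.card := by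
  set B := (G.neighborFinset v).image fun x => (c s(v, x)).getD 0
  refine ⟨Finset.Icc 1 ⌈(1 + ε) * (G.degree v : ℝ)⌉₊ \ B, Finset.sdiff_subset, ?_, ?_⟩
  · intro κ hκ x hx hc
    refine (Finset.mem_sdiff.1 hκ).2 (Finset.mem_image.2 ⟨x, by simpa using hx, ?_⟩)
    simp [hc]
  · have h1 : B.card ≤ G.degree v := Finset.card_image_le
    have h2 := Finset.le_card_sdiff B (Finset.Icc 1 ⌈(1 + ε) * (G.degree v : ℝ)⌉₊)
    rw [Nat.card_Icc, Nat.add_sub_cancel] at h2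
    have h3 := Nat.le_ceil ((1 + ε) * (G.degree v : ℝ))
    have h4 : ⌈(1 + ε) * (G.degree v : ℝ)⌉₊ ≤
        (Finset.Icc 1 ⌈(1 + ε) * (G.degree v : ℝ)⌉₊ \ B).card + G.degree v := by omega
    have h5 : ((⌈(1 + ε) * (G.degree v : ℝ)⌉₊ : ℕ) : ℝ) ≤
        (Finset.Icc 1 ⌈(1 + ε) * (G.degree v : ℝ)⌉₊ \ B).card + G.degree v := by
      exact_mod_cast h4
    linarith

/-- **Existence of small `ε`-local palettes.** There is an absolute constant `C` such
that for any finite simple graph on `n ≥ 2` vertices of maximum degree `Δ ≥ 2`, any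
`0 < ε ≤ 1` and any proper partial edge colouring `c`, there is a set
`S ⊆ {1, …, ⌈(1+ε)Δ⌉}` of size at most `C log n log Δ / ε` such that every vertex `v`
of positive degree has an available colour in `S ∩ {1, …, ⌈(1+ε) d(v)⌉}`. -/
theorem eps_local_palette :
    ∃ C : ℝ, 0 < C ∧
      ∀ (V : Type) [Fintype V] [DecidableEq V] (G : SimpleGraph V) [DecidableRel G.Adj],
        2 ≤ Fintype.card V → 2 ≤ G.maxDegree →
        ∀ ε : ℝ, 0 < ε → ε ≤ 1 →
        ∀ c : Sym2 V → Option ℕ, IsProperPartial G c →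
          ∃ S : Finset ℕ,
            S ⊆ Finset.Icc 1 ⌈(1 + ε) * (G.maxDegree : ℝ)⌉₊ ∧
            (S.card : ℝ) ≤
              C * (Real.log (Fintype.card V) * Real.log (G.maxDegree)) / ε ∧
            ∀ v : V, 1 ≤ G.degree v → ∃ κ ∈ S,
              κ ≤ ⌈(1 + ε) * (G.degree v : ℝ)⌉₊ ∧ Available G c v κ := by
  refine ⟨48, by norm_num, ?_⟩
  intro V _ _ G _ hn hΔ ε hε0 hε1 c _
  set n := Fintype.card V
  set Δ := G.maxDegree
  choose A hAsub hAav hAcard using exists_available_finset G c ε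
  have hclass : ∀ i : ℕ, ∃ S : Finset ℕ, (S.card : ℝ) ≤ 3 * Real.log n / (ε / 4) ∧
      ∀ v ∈ Finset.univ.filter (fun v => 1 ≤ G.degree v ∧ Nat.log 2 (G.degree v) = i),
        ∃ κ ∈ S, κ ∈ A v := by
    intro i
    refine exists_hitting_set_card_le _ (Finset.Icc 1 (4 * 2 ^ i))
      ⟨1, by simp [Nat.succ_le_iff]⟩ A (ε / 4)
      (by positivity) (by linarith) ?_ ?_ n hn (Finset.card_le_univ _)
    · intro v hv
      obtain ⟨-, -, hi⟩ := Finset.mem_filter.1 hv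
      have hlt : G.degree v < 2 ^ (i + 1) := hi ▸ Nat.lt_pow_succ_log_self (by norm_num) _
      refine (hAsub v).trans (Finset.Icc_subset_Icc_right (Nat.ceil_le.2 ?_))
      have h : (G.degree v : ℝ) ≤ 2 ^ (i + 1) := by exact_mod_cast hlt.le
      push_cast
      calc (1 + ε) * (G.degree v : ℝ) ≤ 2 * 2 ^ (i + 1) := by gcongr; linarith
        _ = _ := by ring
    · intro v hv
      obtain ⟨-, hd, hi⟩ := Finset.mem_filter.1 hv
      have hle : 2 ^ i ≤ G.degree v := hi ▸ Nat.pow_log_le_self 2 (by omega)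
      have h : (2 : ℝ) ^ i ≤ G.degree v := by exact_mod_cast hle
      refine le_trans ?_ (hAcard v)
      rw [Nat.card_Icc, Nat.add_sub_cancel]
      push_cast
      nlinarith
  choose S hScard hShit using hclass
  refine ⟨(Finset.range (Nat.log 2 Δ + 1)).biUnion S ∩ Finset.Icc 1 ⌈(1 + ε) * (Δ : ℝ)⌉₊,
    Finset.inter_subset_right, ?_, ?_⟩
  · have hΔ' : (2 : ℝ) ≤ Δ := by exact_mod_cast hΔ
    have hl2 := Real.log_two_gt_d9
    have hlog : Real.log 2 ≤ Real.log Δ := Real.log_le_log (by norm_num) hΔ'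
    have hlogn : 0 ≤ Real.log n := Real.log_natCast_nonneg n
    have hcount : (Nat.log 2 Δ : ℝ) + 1 ≤ 4 * Real.log Δ := by
      have hpow : ((2 : ℝ) ^ Nat.log 2 Δ) ≤ Δ := by
        exact_mod_cast Nat.pow_log_le_self 2 (by omega)
      have := Real.log_le_log (by positivity) hpow
      rw [Real.log_pow] at this
      have h0 : (0 : ℝ) ≤ Nat.log 2 Δ := Nat.cast_nonneg _
      nlinarith
    have hunion : (((Finset.range (Nat.log 2 Δ + 1)).biUnion S
        ∩ Finset.Icc 1 ⌈(1 + ε) * (Δ : ℝ)⌉₊).card : ℝ)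
        ≤ ∑ i ∈ Finset.range (Nat.log 2 Δ + 1), ((S i).card : ℝ) := by
      exact_mod_cast (Finset.card_le_card Finset.inter_subset_left).trans Finset.card_biUnion_le
    calc _ ≤ ∑ i ∈ Finset.range (Nat.log 2 Δ + 1), ((S i).card : ℝ) := hunion
      _ ≤ ∑ i ∈ Finset.range (Nat.log 2 Δ + 1), 3 * Real.log n / (ε / 4) :=
          Finset.sum_le_sum fun i _ => hScard i
      _ = ((Nat.log 2 Δ : ℝ) + 1) * (3 * Real.log n / (ε / 4)) := by simp
      _ ≤ (4 * Real.log Δ) * (3 * Real.log n / (ε / 4)) := by gcongr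
      _ = _ := by field_simp; ring
  · intro v hv
    obtain ⟨κ, hκS, hκA⟩ := hShit (Nat.log 2 (G.degree v)) v (by simp [hv])
    have hdeg : G.degree v ≤ Δ := G.degree_le_maxDegree v
    have hκ := Finset.mem_Icc.1 (hAsub v hκA)
    refine ⟨κ, Finset.mem_inter.2 ⟨Finset.mem_biUnion.2 ⟨_, ?_, hκS⟩, ?_⟩, hκ.2, hAav v κ hκA⟩
    · exact Finset.mem_range.2 (Nat.lt_succ_of_le (Nat.log_mono_right hdeg))
    · refine Finset.mem_Icc.2 ⟨hκ.1, hκ.2.trans (Nat.ceil_mono ?_)⟩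
      gcongr
end

section
/- Let 0 < ε ≤ 1 and let c₁ be a proper partial edge colouring of a finite simple graph G satisfying, for every colour κ, the invariant |{edges e : c₁(e) = κ}| ≤ |{vertices v : κ ≤ ⌈(1+ε)d(v)⌉ and κ ∉ A(v)}|. Let F = (uw₁,…,uw_k) be a fan on an uncoloured edge uv (w₁ = v) whose representative available colours are ε-available (c₁(uw_{i+1}) ∈ A_ε(w_i) for each i < k), let κ₁ ∈ A_ε(u) and κ₂ ∈ A_ε(w_k) with κ₁ ≠ κ₂, and let p₁,…,p_t be an initial segment, starting from w_k, of the (κ₁,κ₂)-bichromatic path having w_k as an endpoint. Let c₂ be obtained from c₁ by shifting the chain (uw₁,…,uw_k, p₁,…,p_t) and, in case p₁,…,p_t is the entire bichromatic path and the shifted chain is augmenting, additionally colouring the resulting uncoloured final edge with whichever of κ₁, κ₂ is then available at both of its endpoints. Then c₂ also satisfies, for every colour κ, the invariant |{edges e : c₂(e) = κ}| ≤ |{vertices v : κ ≤ ⌈(1+ε)d(v)⌉ and κ ∉ A(v)}| (availability taken with respect to c₂). -/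
open SimpleGraph

variable {V : Type*}

/-- The invariant: for every colour `κ`, the number of `κ`-coloured edges is at most the
number of vertices `v` with `κ ≤ ⌈(1+ε) d(v)⌉` at which `κ` is not available. -/
def ColourInvariant (G : SimpleGraph V) [Fintype V] [DecidableRel G.Adj] (ε : ℝ)
    (c : Sym2 V → Option ℕ) : Prop :=
  ∀ κ : ℕ, {e : Sym2 V | c e = some κ}.ncard ≤
    {v : V | κ ≤ ⌈(1 + ε) * (G.degree v : ℝ)⌉₊ ∧ ¬ Available G c v κ}.ncard

/-- The colour `γ` is available (with respect to `c`) at both endpoints of the edge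
`a b`, not counting the edge `a b` itself. -/
def AvailableExceptEdge (G : SimpleGraph V) (c : Sym2 V → Option ℕ) (a b : V)
    (γ : ℕ) : Prop :=
  (∀ z, G.Adj a z → s(a, z) ≠ s(a, b) → c s(a, z) ≠ some γ) ∧
  (∀ z, G.Adj b z → s(b, z) ≠ s(a, b) → c s(b, z) ≠ some γ)

/-- Only edges of `G` are coloured, and edges of the same colour sharing a vertex are equal. -/
def IsMatchingColouring (G : SimpleGraph V) (c : Sym2 V → Option ℕ) : Prop :=
  (∀ e κ, c e = some κ → e ∈ G.edgeSet) ∧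
  ∀ e₁ e₂ κ z, z ∈ e₁ → z ∈ e₂ → c e₁ = some κ → c e₂ = some κ → e₁ = e₂

lemma IsProperPartial.isMatchingColouring {G : SimpleGraph V} {c : Sym2 V → Option ℕ}
    (h : IsProperPartial G c) : IsMatchingColouring G c :=
  ⟨fun e κ he => (h.1 e κ he).1, fun e₁ e₂ κ z h₁ h₂ hc₁ hc₂ => by
    by_contra hne
    exact h.2 e₁ e₂ κ hne ⟨z, h₁, h₂⟩ hc₁ hc₂⟩

lemma available_iff_forall_mem {G : SimpleGraph V} {c : Sym2 V → Option ℕ}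
    (hc : IsMatchingColouring G c) {v : V} {κ : ℕ} :
    Available G c v κ ↔ ∀ e, v ∈ e → c e ≠ some κ := by
  refine ⟨fun h e hv he => ?_, fun h x _ => h _ (Sym2.mem_mk_left v x)⟩
  obtain ⟨x, rfl⟩ := Sym2.mem_iff_exists.1 hv
  exact h x (hc.1 _ _ he) he

/-- The indicator of `κ ≤ B v`. -/
def within (B : V → ℕ) (κ : ℕ) (v : V) : ℤ := if κ ≤ B v then 1 else 0

lemma within_nonneg (B : V → ℕ) (κ : ℕ) (v : V) : 0 ≤ within B κ v := by
  unfold within; split <;> simp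

lemma within_le_one (B : V → ℕ) (κ : ℕ) (v : V) : within B κ v ≤ 1 := by
  unfold within; split <;> simp

lemma within_eq_one {B : V → ℕ} {κ : ℕ} {v : V} (h : κ ≤ B v) : within B κ v = 1 := if_pos h

/-- The number of vertices `v` with `κ ≤ B v` not missing `κ`, minus the number of
`κ`-coloured edges. -/
noncomputable def colourSlack (G : SimpleGraph V) (B : V → ℕ) (c : Sym2 V → Option ℕ)
    (κ : ℕ) : ℤ :=
  ({v : V | κ ≤ B v ∧ ¬ Available G c v κ}.ncard : ℤ) - {e : Sym2 V | c e = some κ}.ncard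

lemma ncard_insert_within [Finite V] (B : V → ℕ) (κ : ℕ) (a : V) (p : V → Prop) (ha : ¬ p a) :
    ({v : V | κ ≤ B v ∧ (v = a ∨ p v)}.ncard : ℤ) =
      {v : V | κ ≤ B v ∧ p v}.ncard + within B κ a := by
  unfold within
  split_ifs with h
  · have : {v : V | κ ≤ B v ∧ (v = a ∨ p v)} = insert a {v : V | κ ≤ B v ∧ p v} := by
      ext v
      simp only [Set.mem_ofPred_eq, Set.mem_insert_iff]
      constructor
      · tauto
      · rintro (rfl | h') <;> tauto
    rw [this, Set.ncard_insert_of_notMem (by simp [ha]) (Set.toFinite _)]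
    push_cast; rfl
  · have : {v : V | κ ≤ B v ∧ (v = a ∨ p v)} = {v : V | κ ≤ B v ∧ p v} := by
      ext v
      simp only [Set.mem_ofPred_eq]
      constructor
      · rintro ⟨h', rfl | h''⟩ <;> tauto
      · tauto
    rw [this]; simp

/-- Effect of colouring an uncoloured edge `ab` with a colour missing at both endpoints. -/
lemma colour_edge [Finite V] [DecidableEq V] {G : SimpleGraph V} (B : V → ℕ)
    {c : Sym2 V → Option ℕ} (hc : IsMatchingColouring G c) {a b : V} {β : ℕ} (hab : G.Adj a b)
    (he : c s(a, b) = none) (ha : Available G c a β) (hb : Available G c b β) :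
    IsMatchingColouring G (Function.update c s(a, b) (some β)) ∧
    colourSlack G B (Function.update c s(a, b) (some β)) β =
      colourSlack G B c β + within B β a + within B β b - 1 ∧
    ∀ κ, κ ≠ β → colourSlack G B (Function.update c s(a, b) (some β)) κ =
      colourSlack G B c κ := by
  set c' := Function.update c s(a, b) (some β) with hc'
  have ha' := (available_iff_forall_mem hc).1 ha
  have hb' := (available_iff_forall_mem hc).1 hb
  have hval : ∀ e κ, c' e = some κ ↔ (e = s(a, b) ∧ κ = β) ∨ c e = some κ := by
    intro e κ
    by_cases h : e = s(a, b)
    · subst h; simp [hc', he, eq_comm]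
    · simp [hc', h]
  have hm : IsMatchingColouring G c' := by
    refine ⟨fun e κ h => ?_, fun e₁ e₂ κ z h₁ h₂ hc₁ hc₂ => ?_⟩
    · rcases (hval e κ).1 h with ⟨rfl, -⟩ | h
      · exact hab
      · exact hc.1 e κ h
    · rcases (hval _ _).1 hc₁ with ⟨rfl, rfl⟩ | hold₁ <;>
        rcases (hval _ _).1 hc₂ with ⟨rfl, hκ⟩ | hold₂
      · rfl
      · rcases Sym2.mem_iff.1 h₁ with rfl | rfl
        · exact absurd hold₂ (ha' _ h₂)
        · exact absurd hold₂ (hb' _ h₂)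
      · subst hκ
        rcases Sym2.mem_iff.1 h₂ with rfl | rfl
        · exact absurd hold₁ (ha' _ h₁)
        · exact absurd hold₁ (hb' _ h₁)
      · exact hc.2 e₁ e₂ κ z h₁ h₂ hold₁ hold₂
  have hav : ∀ v κ, ¬ Available G c' v κ ↔
      ((v = a ∨ v = b) ∧ κ = β) ∨ ¬ Available G c v κ := by
    intro v κ
    rw [available_iff_forall_mem hm, available_iff_forall_mem hc]
    push Not
    constructor
    · rintro ⟨e, hv, h⟩
      rcases (hval _ _).1 h with ⟨rfl, hκ⟩ | h
      · exact Or.inl ⟨Sym2.mem_iff.1 hv, hκ⟩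
      · exact Or.inr ⟨e, hv, h⟩
    · rintro (⟨hv, hκ⟩ | ⟨e, hv, h⟩)
      · exact ⟨s(a, b), Sym2.mem_iff.2 hv, (hval _ _).2 (Or.inl ⟨rfl, hκ⟩)⟩
      · exact ⟨e, hv, (hval _ _).2 (Or.inr h)⟩
  refine ⟨hm, ?_, fun κ hκ => ?_⟩
  · have hE : {e : Sym2 V | c' e = some β} = insert s(a, b) {e | c e = some β} := by
      ext e; simp [hval]
    have hN : {v : V | β ≤ B v ∧ ¬ Available G c' v β} =
        {v : V | β ≤ B v ∧ (v = a ∨ (v = b ∨ ¬ Available G c v β))} := by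
      ext v; simp [hav, or_assoc]
    unfold colourSlack
    rw [hE, Set.ncard_insert_of_notMem (by simp [he]) (Set.toFinite _), hN,
      ncard_insert_within B β a _ (by simp [hab.ne, ha]),
      ncard_insert_within B β b _ (by simp [hb])]
    push_cast; ring
  · have hE : {e : Sym2 V | c' e = some κ} = {e | c e = some κ} := by
      ext e; simp [hval, hκ]
    have hN : {v : V | κ ≤ B v ∧ ¬ Available G c' v κ} =
        {v : V | κ ≤ B v ∧ ¬ Available G c v κ} := by
      ext v; simp [hav, hκ]
    unfold colourSlack
    rw [hE, hN]

/-- Uncolouring an edge keeps the colouring proper and frees its colour at both endpoints. -/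
lemma uncolour_edge [DecidableEq V] {G : SimpleGraph V} {c : Sym2 V → Option ℕ}
    (hc : IsMatchingColouring G c) {e : Sym2 V} {β : ℕ} (he : c e = some β) :
    IsMatchingColouring G (Function.update c e none) ∧
    ∀ v ∈ e, Available G (Function.update c e none) v β := by
  have hval : ∀ f κ, Function.update c e none f = some κ → f ≠ e ∧ c f = some κ := by
    intro f κ
    by_cases h : f = e
    · subst h; simp
    · simp [h]
  have hm : IsMatchingColouring G (Function.update c e none) :=
    ⟨fun f κ h => hc.1 f κ (hval f κ h).2, fun e₁ e₂ κ z h₁ h₂ hc₁ hc₂ =>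
      hc.2 e₁ e₂ κ z h₁ h₂ (hval _ _ hc₁).2 (hval _ _ hc₂).2⟩
  refine ⟨hm, fun v hv => (available_iff_forall_mem hm).2 fun f hf hfβ => ?_⟩
  obtain ⟨hne, hfβ⟩ := hval _ _ hfβ
  exact hne (hc.2 _ _ _ v hf hv hfβ he)

/-- Moving the colour of the edge `pd` to the uncoloured edge `ap`. -/
lemma move_colour [Finite V] [DecidableEq V] {G : SimpleGraph V} (B : V → ℕ)
    {c : Sym2 V → Option ℕ} (hc : IsMatchingColouring G c) {a p d : V} {β : ℕ}
    (hap : G.Adj a p) (hnone : c s(a, p) = none) (hβ : c s(p, d) = some β)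
    (ha : Available G c a β) {c' : Sym2 V → Option ℕ}
    (hc' : c' = Function.update (Function.update c s(p, d) none) s(a, p) (some β)) :
    IsMatchingColouring G c' ∧
    colourSlack G B c' β = colourSlack G B c β + within B β a - within B β d ∧
    ∀ κ, κ ≠ β → colourSlack G B c' κ = colourSlack G B c κ := by
  subst hc'
  obtain ⟨hm, hfree⟩ := uncolour_edge hc hβ
  have hne : s(a, p) ≠ s(p, d) := fun h => by rw [h, hβ] at hnone; cases hnone
  obtain ⟨-, h₁, h₁'⟩ := colour_edge B hm (hc.1 _ _ hβ) (by simp)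
    (hfree p (by simp)) (hfree d (by simp))
  have hback : Function.update (Function.update c s(p, d) none) s(p, d) (some β) = c := by
    rw [Function.update_idem, ← hβ, Function.update_eq_self]
  rw [hback] at h₁ h₁'
  have ha' : Available G (Function.update c s(p, d) none) a β := by
    intro z hz h
    by_cases hzd : s(a, z) = s(p, d)
    · simp [hzd] at h
    · rw [Function.update_of_ne hzd] at h
      exact ha z hz h
  obtain ⟨hm₂, h₂, h₂'⟩ := colour_edge B hm hap (by rw [Function.update_of_ne hne, hnone])
    ha' (hfree p (by simp))
  exact ⟨hm₂, by linarith, fun κ hκ => by rw [h₂' κ hκ, h₁' κ hκ]⟩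

/-- The colouring obtained by shifting the first `s + 1` edges of the chain `E`. -/
def shiftChain [DecidableEq V] (c : Sym2 V → Option ℕ) (E : ℕ → Sym2 V) :
    ℕ → Sym2 V → Option ℕ
  | 0 => c
  | s + 1 => Function.update (Function.update (shiftChain c E s) (E (s + 1)) none)
      (E s) (c (E (s + 1)))

lemma shiftChain_spec [DecidableEq V] {c : Sym2 V → Option ℕ} {E : ℕ → Sym2 V}
    (h0 : c (E 0) = none) (s : ℕ) (hE : Set.InjOn E (Set.Iic s)) :
    shiftChain c E s (E s) = none ∧
    (∀ j < s, shiftChain c E s (E j) = c (E (j + 1))) ∧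
    ∀ f, (∀ j ≤ s, f ≠ E j) → shiftChain c E s f = c f := by
  induction s with
  | zero => exact ⟨h0, by simp, fun _ _ => rfl⟩
  | succ s ih =>
    obtain ⟨-, ih₂, ih₃⟩ := ih (hE.mono (Set.Iic_subset_Iic.2 (Nat.le_succ s)))
    have hne : ∀ i ≤ s + 1, ∀ j ≤ s + 1, i ≠ j → E i ≠ E j :=
      fun i hi j hj hij h => hij (hE hi hj h)
    refine ⟨?_, fun j hj => ?_, fun f hf => ?_⟩
    · simp [shiftChain, hne (s + 1) le_rfl s (by omega) (by omega)]
    · rcases Nat.lt_succ_iff_lt_or_eq.1 hj with hj | rfl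
      · simp [shiftChain, hne j (by omega) s (by omega) (by omega),
          hne j (by omega) (s + 1) le_rfl (by omega), ih₂ j hj]
      · simp [shiftChain]
    · simp [shiftChain, hf s (by omega), hf (s + 1) le_rfl, ih₃ f fun j hj => hf j (by omega)]

/-- Shifting an `ε`-local fan preserves properness and the invariant. -/
lemma shiftChain_fan [Finite V] [DecidableEq V] {G : SimpleGraph V} (B : V → ℕ)
    {c : Sym2 V → Option ℕ} (hc : IsMatchingColouring G c)
    (hinv : ∀ κ, 0 ≤ colourSlack G B c κ) {u : V} {w : ℕ → V} (s : ℕ)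
    (hw : Set.InjOn w (Set.Iic s)) (hadj : ∀ i ≤ s, G.Adj u (w i)) (h0 : c s(u, w 0) = none)
    (hrep : ∀ i < s, ∃ β, c s(u, w (i + 1)) = some β ∧ Available G c (w i) β ∧ β ≤ B (w i)) :
    IsMatchingColouring G (shiftChain c (fun i => s(u, w i)) s) ∧
    ∀ κ, 0 ≤ colourSlack G B (shiftChain c (fun i => s(u, w i)) s) κ := by
  induction s with
  | zero => exact ⟨hc, hinv⟩
  | succ s ih =>
    have hw' : Set.InjOn w (Set.Iic s) := hw.mono (Set.Iic_subset_Iic.2 (Nat.le_succ s))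
    obtain ⟨hm, hs⟩ := ih hw' (fun i hi => hadj i (by omega)) (fun i hi => hrep i (by omega))
    have hE : ∀ n, Set.InjOn w (Set.Iic n) → Set.InjOn (fun i => s(u, w i)) (Set.Iic n) :=
      fun n hn i hi j hj h => hn hi hj (Sym2.congr_right.1 h)
    obtain ⟨hs₁, -, hs₃⟩ := shiftChain_spec (E := fun i => s(u, w i)) h0 s (hE s hw')
    obtain ⟨β, hβ, hav, hle⟩ := hrep s (by omega)
    have hnew : ∀ j ≤ s, s(u, w (s + 1)) ≠ s(u, w j) := fun j hj h => by
      have := hw (by simp) (by simp; omega) (Sym2.congr_right.1 h)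
      omega
    have hav' : Available G (shiftChain c (fun i => s(u, w i)) s) (w s) β := by
      intro z hz h
      by_cases hf : ∃ j ≤ s, s(w s, z) = s(u, w j)
      · obtain ⟨j, hj, hf⟩ := hf
        rcases Sym2.eq_iff.1 hf with ⟨h', -⟩ | ⟨h', -⟩
        · exact (hadj s (by omega)).ne h'.symm
        · obtain rfl := hw' (by simp) (by simpa using hj) h'
          rw [hf, hs₁] at h
          cases h
      · push Not at hf
        rw [hs₃ _ hf] at h
        exact hav z hz h
    obtain ⟨hm', h₁, h₂⟩ := move_colour B hm (hadj s (by omega)).symm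
      (by rw [Sym2.eq_swap]; exact hs₁) (by rw [hs₃ _ hnew]; exact hβ) hav'
      (c' := shiftChain c (fun i => s(u, w i)) (s + 1))
      (by simp only [shiftChain]; rw [hβ, Sym2.eq_swap (a := w s)])
    refine ⟨hm', fun κ => ?_⟩
    by_cases hκ : κ = β
    · subst hκ
      rw [h₁, within_eq_one hle]
      linarith [hs κ, within_le_one B κ (w (s + 1))]
    · rw [h₂ κ hκ]; exact hs κ

/-- Shifting an alternating path, together with the slack left for its two colours at the
endpoints of the uncoloured edge. -/
lemma shiftChain_path [Finite V] [DecidableEq V] {G : SimpleGraph V} (B : V → ℕ)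
    {c : Sym2 V → Option ℕ} (hc : IsMatchingColouring G c)
    (hinv : ∀ κ, 0 ≤ colourSlack G B c κ) {y : ℕ → V} {col : ℕ → ℕ}
    (hcol : ∀ j, col (j + 2) = col j) (hcol01 : ∀ j, col j ≠ col (j + 1))
    (hadj : G.Adj (y 0) (y 1)) (h0 : c s(y 0, y 1) = none)
    (hav0 : Available G c (y 0) (col 0)) (hav1 : Available G c (y 1) (col 1))
    (hle0 : col 0 ≤ B (y 0)) (hle1 : col 1 ≤ B (y 1)) (s : ℕ)
    (hE : Set.InjOn (fun i => s(y i, y (i + 1))) (Set.Iic s))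
    (hpath : ∀ j < s, c s(y (j + 1), y (j + 2)) = some (col j)) :
    IsMatchingColouring G (shiftChain c (fun i => s(y i, y (i + 1))) s) ∧
    (∀ κ, 0 ≤ colourSlack G B (shiftChain c (fun i => s(y i, y (i + 1))) s) κ) ∧
    Available G (shiftChain c (fun i => s(y i, y (i + 1))) s) (y s) (col s) ∧
    Available G (shiftChain c (fun i => s(y i, y (i + 1))) s) (y (s + 1)) (col (s + 1)) ∧
    1 ≤ colourSlack G B (shiftChain c (fun i => s(y i, y (i + 1))) s) (col s) +
      within B (col s) (y s) ∧
    1 ≤ colourSlack G B (shiftChain c (fun i => s(y i, y (i + 1))) s) (col (s + 1)) +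
      within B (col (s + 1)) (y (s + 1)) ∧
    G.Adj (y s) (y (s + 1)) := by
  induction s with
  | zero =>
    refine ⟨hc, hinv, hav0, hav1, ?_, ?_, hadj⟩
    · rw [within_eq_one hle0]; simpa [shiftChain] using hinv _
    · rw [within_eq_one hle1]; simpa [shiftChain] using hinv _
  | succ s ih =>
    have hE' := hE.mono (Set.Iic_subset_Iic.2 (Nat.le_succ s))
    obtain ⟨hm, hs, ha, hb, hsa, hsb, hadj'⟩ := ih hE' fun j hj => hpath j (by omega)
    obtain ⟨hs₁, -, hs₃⟩ := shiftChain_spec (E := fun i => s(y i, y (i + 1))) h0 s hE'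
    have hβ := hpath s (by omega)
    have hnew : ∀ j ≤ s, s(y (s + 1), y (s + 2)) ≠ s(y j, y (j + 1)) := fun j hj h => by
      have := hE (x₁ := s + 1) (x₂ := j) (by simp) (by simp; omega) h
      omega
    set c₀ := shiftChain c (fun i => s(y i, y (i + 1))) s with hc₀
    have hβ' : c₀ s(y (s + 1), y (s + 2)) = some (col s) := by rw [hs₃ _ hnew]; exact hβ
    have hdef : shiftChain c (fun i => s(y i, y (i + 1))) (s + 1) =
        Function.update (Function.update c₀ s(y (s + 1), y (s + 2)) none)
          s(y s, y (s + 1)) (some (col s)) := by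
      simp only [shiftChain]; rw [← hc₀, hβ]
    obtain ⟨hm', h₁, h₂⟩ := move_colour B hm hadj' hs₁ hβ' ha hdef
    have hadj'' : G.Adj (y (s + 1)) (y (s + 2)) := hc.1 _ _ hβ
    set c' := shiftChain c (fun i => s(y i, y (i + 1))) (s + 1)
    have hval : ∀ f κ, c' f = some κ →
        (f = s(y s, y (s + 1)) ∧ κ = col s) ∨
          (f ≠ s(y (s + 1), y (s + 2)) ∧ c₀ f = some κ) := by
      intro f κ h
      rw [hdef] at h
      by_cases hf : f = s(y s, y (s + 1))
      · subst hf; simp at h; exact Or.inl ⟨rfl, h.symm⟩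
      · rw [Function.update_of_ne hf] at h
        by_cases hf' : f = s(y (s + 1), y (s + 2))
        · subst hf'; simp at h
        · rw [Function.update_of_ne hf'] at h
          exact Or.inr ⟨hf', h⟩
    have hy : y (s + 2) ≠ y s := fun h => by
      rw [h, Sym2.eq_swap, hs₁] at hβ'; cases hβ'
    refine ⟨hm', fun κ => ?_, fun z hz h => ?_, fun z hz h => ?_, ?_, ?_, hadj''⟩
    · by_cases hκ : κ = col s
      · subst hκ
        rw [h₁]
        linarith [within_le_one B (col s) (y (s + 2))]
      · rw [h₂ κ hκ]; exact hs κ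
    · rcases hval _ _ h with ⟨-, h⟩ | ⟨-, h⟩
      · exact hcol01 s h.symm
      · exact hb z hz h
    · rw [hcol] at h
      rcases hval _ _ h with ⟨h, -⟩ | ⟨hf, h⟩
      · rcases Sym2.eq_iff.1 h with ⟨h, -⟩ | ⟨h, -⟩
        · exact hy h
        · exact hadj''.ne h.symm
      · exact hf (hm.2 _ _ _ (y (s + 2)) (by simp) (by simp) h hβ')
    · rw [h₂ _ (hcol01 s).symm]; exact hsb
    · rw [hcol, h₁]; linarith

/-- **Shifting an `ε`-local Vizing chain preserves the invariant.** `c₂` is obtained from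
`c₁` by shifting the chain consisting of the fan `(u w 0, …, u w (k-1))` (whose
representative available colours are `ε`-available) followed by an initial segment
`x 0 x 1, …, x (t-1) x t` of the `(κ₁,κ₂)`-bichromatic path starting at `w (k-1)`, where
`κ₁ ∈ A_ε(u)`, `κ₂ ∈ A_ε(w (k-1))`, `κ₁ ≠ κ₂`; if the segment is the entire path and the
shifted chain is augmenting, the final uncoloured edge is additionally coloured with
whichever of `κ₁, κ₂` is then available at both of its endpoints. -/
theorem eps_local_shift_invariant (V : Type*) [Fintype V] [DecidableEq V]
    (G : SimpleGraph V) [DecidableRel G.Adj]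
    (ε : ℝ) (hε0 : 0 < ε) (hε1 : ε ≤ 1)
    (c₁ c₂ : Sym2 V → Option ℕ) (hc₁ : IsProperPartial G c₁)
    (hinv : ColourInvariant G ε c₁)
    (u : V) (w : ℕ → V) (k : ℕ) (hk : 1 ≤ k)
    (hfan : IsFan G c₁ u w k)
    (hfanε : ∀ i β, i + 1 < k → c₁ s(u, w (i + 1)) = some β →
      β ≤ ⌈(1 + ε) * (G.degree (w i) : ℝ)⌉₊)
    (κ₁ κ₂ : ℕ) (hne : κ₁ ≠ κ₂)
    (hκ₁u : Available G c₁ u κ₁) (hκ₁ε : κ₁ ≤ ⌈(1 + ε) * (G.degree u : ℝ)⌉₊)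
    (hκ₂wk : Available G c₁ (w (k - 1)) κ₂)
    (hκ₂ε : κ₂ ≤ ⌈(1 + ε) * (G.degree (w (k - 1)) : ℝ)⌉₊)
    (x : ℕ → V) (t : ℕ) (hx0 : x 0 = w (k - 1))
    (hinj : Set.InjOn x (Set.Iic t))
    (hadj : ∀ j < t, G.Adj (x j) (x (j + 1)))
    (hcol : ∀ j < t, c₁ s(x j, x (j + 1)) = some (if Even j then κ₁ else κ₂))
    -- the shift:
    (hshiftFan : ∀ j, j + 1 < k → c₂ s(u, w j) = c₁ s(u, w (j + 1)))
    (hshiftPath : ∀ j, j + 1 < t → c₂ s(x j, x (j + 1)) = some (if Even j then κ₂ else κ₁))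
    (hjunction : t = 0 ∨ c₂ s(u, w (k - 1)) = some κ₁)
    (hlast :
      (t = 0 ∧
        (c₂ s(u, w (k - 1)) = none ∨
          (Available G c₁ (w (k - 1)) κ₁ ∧
            ∃ γ, (γ = κ₁ ∨ γ = κ₂) ∧ c₂ s(u, w (k - 1)) = some γ ∧
              AvailableExceptEdge G c₂ u (w (k - 1)) γ))) ∨
      (1 ≤ t ∧
        (c₂ s(x (t - 1), x t) = none ∨
          (Available G c₁ (x t) (if Even t then κ₁ else κ₂) ∧
            ∃ γ, (γ = κ₁ ∨ γ = κ₂) ∧ c₂ s(x (t - 1), x t) = some γ ∧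
              AvailableExceptEdge G c₂ (x (t - 1)) (x t) γ))))
    (hshiftRest : ∀ f, (∀ j < k, f ≠ s(u, w j)) →
      (∀ j < t, f ≠ s(x j, x (j + 1))) → c₂ f = c₁ f) :
    ColourInvariant G ε c₂ := by
  obtain ⟨hw, hwadj, hw0, hwrep⟩ := hfan
  have hm := hc₁.isMatchingColouring
  set B : V → ℕ := fun v => ⌈(1 + ε) * (G.degree v : ℝ)⌉₊ with hB
  have hslack : ∀ c, ColourInvariant G ε c ↔ ∀ κ, 0 ≤ colourSlack G B c κ := fun c => by
    simp [ColourInvariant, colourSlack, hB]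
  rw [hslack] at hinv ⊢
  obtain ⟨n, rfl⟩ : ∃ n, k = n + 1 := ⟨k - 1, by omega⟩
  simp only [Nat.add_sub_cancel] at *
  have hwn : Set.InjOn w (Set.Iic n) := hw.mono fun i hi => Nat.lt_succ_of_le hi
  set F : ℕ → Sym2 V := fun i => s(u, w i) with hF
  have hFinj : Set.InjOn F (Set.Iic n) := fun i hi j hj h => hwn hi hj (Sym2.congr_right.1 h)
  have hu := (available_iff_forall_mem hm).1 hκ₁u
  have hwn₂ := (available_iff_forall_mem hm).1 hκ₂wk
  have huF : ∀ i, u ∈ F i := fun i => Sym2.mem_mk_left _ _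
  -- the hypotheses on `c₂` force the path to avoid the fan
  have hdisj : ∀ j < t, ∀ i ≤ n, s(x j, x (j + 1)) ≠ F i := by
    intro j hj i hi h
    have hcj := hcol j hj
    rw [h] at hcj
    have hodd : ¬ Even j := fun he => hu _ (huF i) (by simpa [he] using hcj)
    rw [if_neg hodd] at hcj
    have hin : i ≠ n := by
      rintro rfl
      exact hwn₂ _ (Sym2.mem_mk_right _ _) hcj
    obtain ⟨β, hβ, -⟩ := hwrep i (by omega)
    have h₂ := hshiftFan i (by omega)
    have hβ₁ : β ≠ κ₁ := by rintro rfl; exact hu _ (huF (i + 1)) hβ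
    have hβ₂ : β ≠ κ₂ := by
      rintro rfl
      have := hFinj (by simpa using hi) (by simp; omega)
        (hm.2 _ _ _ u (huF i) (huF (i + 1)) hcj hβ)
      omega
    have hc₂ : c₂ s(x j, x (j + 1)) = some β := by rw [h, ← hβ]; exact h₂
    by_cases hjt : j + 1 < t
    · rw [hshiftPath j hjt, if_neg hodd] at hc₂
      exact hβ₁ (Option.some_injective _ hc₂).symm
    · obtain rfl : t = j + 1 := by omega
      simp only [Nat.add_sub_cancel] at hlast
      rcases hlast with ⟨h, -⟩ | ⟨-, h | ⟨-, γ, hγ, h, -⟩⟩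
      · omega
      · rw [h] at hc₂; cases hc₂
      · rw [h] at hc₂
        obtain rfl := Option.some_injective _ hc₂
        tauto
  -- shifting the fan
  obtain ⟨hmf, hsf⟩ := shiftChain_fan B hm hinv n hwn (fun i hi => hwadj i (by omega)) hw0
    (fun i hi => by
      obtain ⟨β, hβ, hav⟩ := hwrep i (by omega)
      exact ⟨β, hβ, hav, hfanε i β (by omega) hβ⟩)
  obtain ⟨hf₁, hf₂, hf₃⟩ := shiftChain_spec (E := F) hw0 n hFinj
  rw [← hF] at hmf hsf
  set cf := shiftChain c₁ F n
  have hcfu : Available G cf u κ₁ := by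
    intro z hz h
    by_cases hf : ∃ j ≤ n, s(u, z) = F j
    · obtain ⟨j, hj, hf⟩ := hf
      rw [hf] at h
      rcases hj.lt_or_eq with hj | rfl
      · rw [hf₂ j hj] at h
        exact hu _ (huF _) h
      · rw [hf₁] at h; cases h
    · push Not at hf
      rw [hf₃ _ hf] at h
      exact hκ₁u z hz h
  have hcfw : Available G cf (w n) κ₂ := by
    intro z hz h
    by_cases hf : ∃ j ≤ n, s(w n, z) = F j
    · obtain ⟨j, hj, hf⟩ := hf
      rcases Sym2.eq_iff.1 hf with ⟨h', -⟩ | ⟨h', -⟩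
      · exact (hwadj n (by omega)).ne h'.symm
      · obtain rfl := hwn (by simp) (by simpa using hj) h'
        rw [hf, hf₁] at h
        cases h
    · push Not at hf
      rw [hf₃ _ hf] at h
      exact hκ₂wk z hz h
  -- shifting the path
  set y : ℕ → V := fun m => Nat.casesOn m u x with hy
  set col : ℕ → ℕ := fun j => if Even j then κ₁ else κ₂ with hcoldef
  have hcol' : ∀ j < t, cf s(x j, x (j + 1)) = some (col j) := fun j hj => by
    rw [hf₃ _ (hdisj j hj)]; exact hcol j hj
  set E : ℕ → Sym2 V := fun i => s(y i, y (i + 1)) with hEdef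
  have hE0 : E 0 = s(u, w n) := by simp [hEdef, hy, hx0]
  have hEs : ∀ j, E (j + 1) = s(x j, x (j + 1)) := fun j => rfl
  have hcf0 : cf (E 0) = none := by rw [hE0]; exact hf₁
  have hE : Set.InjOn E (Set.Iic t) := by
    intro i hi j hj h
    simp only [Set.mem_Iic] at hi hj
    rcases i with _ | i <;> rcases j with _ | j
    · rfl
    · rw [h, hEs, hcol' j (by omega)] at hcf0; cases hcf0
    · rw [← h, hEs, hcol' i (by omega)] at hcf0; cases hcf0
    · rw [hEs, hEs] at h
      have hx : ∀ a ≤ t, ∀ b ≤ t, x a = x b → a = b := fun a ha b hb h => hinj ha hb h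
      rcases Sym2.eq_iff.1 h with ⟨h, -⟩ | ⟨h, h'⟩
      · rw [hx _ (by omega) _ (by omega) h]
      · have := hx _ (by omega) _ (by omega) h
        have := hx _ (by omega) _ (by omega) h'
        omega
  obtain ⟨hmp, hsp, hpa, hpb, hsa, hsb, hadjt⟩ := shiftChain_path B hmf hsf (y := y) (col := col)
    (fun j => by simp [hcoldef, Nat.even_add])
    (fun j => by by_cases hj : Even j <;> simp [hcoldef, Nat.even_add_one, hj, hne, hne.symm])
    (by simpa [hy, hx0] using hwadj n (by omega)) hcf0 (by simpa [hy, hcoldef] using hcfu)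
    (by simpa [hy, hcoldef, hx0] using hcfw) (by simpa [hy, hcoldef] using hκ₁ε)
    (by simpa [hy, hcoldef, hx0] using hκ₂ε) t hE hcol'
  obtain ⟨hp₁, hp₂, hp₃⟩ := shiftChain_spec (E := E) hcf0 t hE
  rw [← hEdef] at hmp hsp hpa hpb hsa hsb
  set cp := shiftChain cf E t
  have hagree : ∀ f, f ≠ E t → c₂ f = cp f := by
    intro f hft
    by_cases hf : ∃ j ≤ t, f = E j
    · obtain ⟨j, hj, rfl⟩ := hf
      have hjt : j < t := hj.lt_of_ne fun h => hft (by rw [h])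
      rw [hp₂ j hjt, hEs, hcol' j hjt]
      rcases j with _ | j
      · rw [hE0, hjunction.resolve_left (by omega)]; simp [hcoldef]
      · rw [hEs, hshiftPath j hjt]
        by_cases h : Even j <;> simp [hcoldef, Nat.even_add_one, h]
    · push Not at hf
      rw [hp₃ f hf]
      have hfn : f ≠ F n := by rw [← show E 0 = F n from hE0]; exact hf 0 (by omega)
      by_cases hff : ∃ j ≤ n, f = F j
      · obtain ⟨j, hj, rfl⟩ := hff
        have hjn : j < n := hj.lt_of_ne fun h => hfn (by rw [h])
        rw [hf₂ j hjn]
        exact hshiftFan j (by omega)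
      · push Not at hff
        rw [hf₃ f hff]
        exact hshiftRest f (fun j hj => hff j (by omega)) fun j hj => hf (j + 1) hj
  have hfinal : c₂ (E t) = none ∨ ∃ γ, (γ = col t ∨ γ = col (t + 1)) ∧ c₂ (E t) = some γ ∧
      AvailableExceptEdge G c₂ (y t) (y (t + 1)) γ := by
    have hγ : ∀ γ, (γ = κ₁ ∨ γ = κ₂) → (γ = col t ∨ γ = col (t + 1)) := fun γ h => by
      by_cases ht : Even t <;> simp [hcoldef, Nat.even_add_one, ht] <;> tauto
    rcases hlast with ⟨rfl, h | ⟨-, γ, h₁, h₂, h₃⟩⟩ | ⟨ht, h⟩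
    · left; rw [hE0]; exact h
    · right
      refine ⟨γ, hγ γ h₁, by rw [hE0]; exact h₂, ?_⟩
      have h1 : y (0 + 1) = w n := hx0
      rw [h1]; exact h₃
    · obtain ⟨m, rfl⟩ : ∃ m, t = m + 1 := ⟨t - 1, by omega⟩
      rcases h with h | ⟨-, γ, h₁, h₂, h₃⟩
      · exact Or.inl h
      · exact Or.inr ⟨γ, hγ γ h₁, h₂, h₃⟩
  rcases hfinal with hnone | ⟨γ, hγ, hsome, hav⟩
  · have : c₂ = cp := by
      funext f
      by_cases hf : f = E t
      · rw [hf, hnone, hp₁]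
      · exact hagree f hf
    rw [this]; exact hsp
  · have : c₂ = Function.update cp s(y t, y (t + 1)) (some γ) := by
      funext f
      by_cases hf : f = E t
      · rw [hf, hsome]; simp [hEdef]
      · rw [hagree f hf, Function.update_of_ne hf]
    have hav' : ∀ v, (∀ z, G.Adj v z → s(v, z) ≠ E t → c₂ s(v, z) ≠ some γ) →
        Available G cp v γ := by
      intro v hv z hz h
      by_cases hf : s(v, z) = E t
      · rw [hf, hp₁] at h; cases h
      · exact hv z hz hf (by rw [hagree _ hf]; exact h)
    obtain ⟨-, h₁, h₂⟩ := colour_edge B hmp hadjt hp₁ (hav' _ hav.1) (hav' _ hav.2)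
    rw [this]
    intro κ
    by_cases hκ : κ = γ
    · subst hκ
      rw [h₁]
      have := within_nonneg B κ (y t)
      have := within_nonneg B κ (y (t + 1))
      rcases hγ with rfl | rfl <;> linarith
    · rw [h₂ κ hκ]; exact hsp κ
end
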